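/- arXiv:1609.03798 — 3 statements merged into one kernel-verified Lean document; each statement's English description precedes it below -/
import Mathlib

section
/- Fix a compact set L ⊂ (0,∞). Then √(log n) · sup_{θ∈L} max_{1≤k≤n} | L_n(θ,k) − e^{−x_n(k,θ)²/2} / √(2π θ log n) | tends to 0 as n → ∞. (This is the r = 0 case of the Edgeworth expansion for the Ewens distribution, i.e. a uniform local central limit theorem with error o(1/√(log n)).) -/
open Real Filter

/-- The Ewens probability mass function with parameter `θ`:
`L_n(θ,k) = θ^k ⟦n,k⟧ / θ^{(n)}`. -/
noncomputable def ewensPMF (n : ℕ) (θ : ℝ) (k : ℕ) : ℝ :=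
  θ ^ k * ((ascPochhammer ℕ n).coeff k : ℝ) / (ascPochhammer ℝ n).eval θ

/-- The normalization `x_n(k,θ) = (k − θ log n)/√(θ log n)`. -/
noncomputable def xnorm (n k : ℕ) (θ : ℝ) : ℝ :=
  ((k : ℝ) - θ * Real.log n) / Real.sqrt (θ * Real.log n)

/-- The characteristic function of the Ewens distribution, written as the product of the
characteristic functions of independent Bernoulli variables of parameters `θ / (θ + j)`. -/
noncomputable def ewensCharFun (n : ℕ) (θ t : ℝ) : ℂ :=
  ∏ j ∈ Finset.range n, (1 + ((θ / (θ + j) : ℝ) : ℂ) * (Complex.exp (t * Complex.I) - 1))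

lemma ascPochhammer_eval_eq_prod_range {S : Type*} [CommSemiring S] (n : ℕ) (x : S) :
    (ascPochhammer S n).eval x = ∏ j ∈ Finset.range n, (x + j) := by
  induction n with
  | zero => simp
  | succ n ih => rw [ascPochhammer_succ_eval, ih, Finset.prod_range_succ]

lemma continuous_ewensCharFun (n : ℕ) (θ : ℝ) : Continuous (ewensCharFun n θ) := by
  unfold ewensCharFun
  fun_prop

lemma ewensCharFun_eq_sum (n : ℕ) {θ : ℝ} (hθ : 0 < θ) (t : ℝ) :
    ewensCharFun n θ t =
      ∑ k ∈ Finset.range (n + 1), (ewensPMF n θ k : ℂ) * Complex.exp (k * (t * Complex.I)) := by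
  have hprod : (∏ j ∈ Finset.range n, ((θ : ℂ) + j)) ≠ 0 := by
    refine Finset.prod_ne_zero_iff.2 fun j _ => ?_
    exact_mod_cast (by positivity : θ + (j : ℝ) ≠ 0)
  have h1 : ewensCharFun n θ t = (ascPochhammer ℂ n).eval (θ * Complex.exp (t * Complex.I)) /
      ∏ j ∈ Finset.range n, ((θ : ℂ) + j) := by
    rw [ewensCharFun, ascPochhammer_eval_eq_prod_range, ← Finset.prod_div_distrib]
    refine Finset.prod_congr rfl fun j _ => ?_
    have : (θ : ℂ) + j ≠ 0 := by exact_mod_cast (by positivity : θ + (j : ℝ) ≠ 0)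
    push_cast
    field_simp
    ring
  rw [h1, ← ascPochhammer_map (Nat.castRingHom ℂ), Polynomial.eval_map,
    Polynomial.eval₂_eq_sum_range, ascPochhammer_natDegree, Finset.sum_div]
  refine Finset.sum_congr rfl fun k _ => ?_
  rw [ewensPMF, ascPochhammer_eval_eq_prod_range, mul_pow, ← Complex.exp_nat_mul]
  push_cast [eq_natCast]
  ring

lemma integral_exp_int_mul_I (m : ℤ) :
    ∫ t in (-π)..π, Complex.exp (m * (t * Complex.I)) = if m = 0 then 2 * (π : ℂ) else 0 := by
  split_ifs with h
  · simp [h]; ring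
  · have hc : (m : ℂ) * Complex.I ≠ 0 := by simp [h]
    have h2 := integral_exp_mul_complex (a := -π) (b := π) hc
    have e : Complex.exp (m * Complex.I * (π : ℝ)) = Complex.exp (m * Complex.I * (-π : ℝ)) := by
      rw [Complex.exp_eq_exp_iff_exists_int]
      exact ⟨m, by push_cast; ring⟩
    rw [e, sub_self, zero_div] at h2
    rw [← h2]
    congr 1; ext t; ring_nf

lemma ewensPMF_eq_integral {n : ℕ} {θ : ℝ} (hθ : 0 < θ) {k : ℕ} (hk : k ≤ n) :
    2 * π * (ewensPMF n θ k : ℂ) =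
      ∫ t in (-π)..π, ewensCharFun n θ t * Complex.exp (-k * (t * Complex.I)) := by
  have h : ∀ t : ℝ, ewensCharFun n θ t * Complex.exp (-k * (t * Complex.I)) =
      ∑ l ∈ Finset.range (n + 1), (ewensPMF n θ l : ℂ) *
        Complex.exp (((l : ℤ) - (k : ℤ) : ℤ) * (t * Complex.I)) := by
    intro t
    rw [ewensCharFun_eq_sum n hθ, Finset.sum_mul]
    refine Finset.sum_congr rfl fun l _ => ?_
    rw [mul_assoc, ← Complex.exp_add]
    congr 2; push_cast; ring
  simp_rw [h]
  rw [intervalIntegral.integral_finsetSum fun l _ =>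
    Continuous.intervalIntegrable (by fun_prop) _ _]
  simp_rw [intervalIntegral.integral_const_mul, integral_exp_int_mul_I, sub_eq_zero, Nat.cast_inj]
  rw [Finset.sum_eq_single k (fun l _ hl => by simp [hl])
    (fun h => absurd (Finset.mem_range.2 (by omega)) h)]
  simp; ring

/-- The exponent of the Gaussian approximation to a characteristic function of unit intensity. -/
noncomputable def gaussExponent (t : ℝ) : ℂ := t * Complex.I - (t : ℂ) ^ 2 / 2

lemma continuous_gaussExponent : Continuous gaussExponent := by
  unfold gaussExponent
  fun_prop

lemma gaussExponent_re (t : ℝ) : (gaussExponent t).re = -(t ^ 2 / 2) := by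
  have : gaussExponent t = ((-(t ^ 2 / 2) : ℝ) : ℂ) + (t : ℝ) * Complex.I := by
    unfold gaussExponent; push_cast; ring
  rw [this]; simp [-Complex.ofReal_neg, -Complex.ofReal_div, -Complex.ofReal_pow]

lemma norm_exp_mul_gaussExponent (c t : ℝ) :
    ‖Complex.exp (c * gaussExponent t)‖ = Real.exp (-(c / 2) * t ^ 2) := by
  rw [Complex.norm_exp, Complex.re_ofReal_mul, gaussExponent_re]
  congr 1; ring

lemma norm_exp_mul_gaussExponent_le_one {c : ℝ} (hc : 0 ≤ c) (t : ℝ) :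
    ‖Complex.exp (c * gaussExponent t)‖ ≤ 1 := by
  rw [norm_exp_mul_gaussExponent, Real.exp_le_one_iff]
  have : 0 ≤ c / 2 * t ^ 2 := by positivity
  linarith

lemma norm_gaussExponent_le {t : ℝ} (ht : |t| ≤ 1 / 2) : ‖gaussExponent t‖ ≤ 2 * |t| := by
  have h : ‖gaussExponent t‖ ≤ |t| + |t| ^ 2 / 2 := by
    refine (norm_sub_le _ _).trans (le_of_eq ?_)
    simp
  nlinarith [abs_nonneg t]

lemma integral_gaussExponent {c : ℝ} (hc : 0 < c) (k : ℕ) :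
    ∫ t : ℝ, Complex.exp (c * gaussExponent t) * Complex.exp (-k * (t * Complex.I)) =
      2 * π * ((Real.exp (-((k - c) / Real.sqrt c) ^ 2 / 2) / Real.sqrt (2 * π * c) : ℝ) : ℂ) := by
  have h := fourierIntegral_gaussian (b := ((c / 2 : ℝ) : ℂ)) (by simpa using hc)
    (((c - k : ℝ)) : ℂ)
  have h2 : ∀ t : ℝ, Complex.exp (c * gaussExponent t) * Complex.exp (-k * (t * Complex.I)) =
      Complex.exp (Complex.I * ((c - k : ℝ) : ℂ) * t) *
        Complex.exp (-((c / 2 : ℝ) : ℂ) * t ^ 2) := by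
    intro t
    rw [← Complex.exp_add, ← Complex.exp_add, gaussExponent]
    congr 1; push_cast; ring
  simp_rw [h2]
  rw [h]
  have h3 : ((π : ℂ) / ((c / 2 : ℝ) : ℂ)) ^ (1 / 2 : ℂ) =
      ((2 * π / Real.sqrt (2 * π * c) : ℝ) : ℂ) := by
    rw [← Complex.ofReal_div, show (1 / 2 : ℂ) = ((1 / 2 : ℝ) : ℂ) by push_cast; rfl,
      ← Complex.ofReal_cpow (by positivity), ← Real.sqrt_eq_rpow]
    congr 1
    rw [Real.sqrt_eq_iff_mul_self_eq (by positivity) (by positivity)]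
    rw [div_mul_div_comm, Real.mul_self_sqrt (by positivity)]
    field_simp
  have h4 : -((k - c) / Real.sqrt c) ^ 2 / 2 = -(c - k) ^ 2 / (4 * (c / 2)) := by
    rw [div_pow, Real.sq_sqrt hc.le]
    field_simp
    ring
  rw [h3, h4]
  push_cast
  ring

lemma integrable_gaussExponent {c : ℝ} (hc : 0 < c) (k : ℕ) :
    MeasureTheory.Integrable fun t : ℝ =>
      Complex.exp (c * gaussExponent t) * Complex.exp (-k * (t * Complex.I)) := by
  refine (integrable_exp_neg_mul_sq (half_pos hc)).mono'
    (Continuous.aestronglyMeasurable ?_) (.of_forall fun t => ?_)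
  · have := continuous_gaussExponent
    fun_prop
  · have : ‖Complex.exp (-k * (t * Complex.I))‖ = 1 := by
      simp [Complex.norm_exp]
    rw [norm_mul, norm_exp_mul_gaussExponent, this, mul_one]

lemma norm_prod_sub_prod_le {ι : Type*} (s : Finset ι) (f g : ι → ℂ)
    (hf : ∀ i ∈ s, ‖f i‖ ≤ 1) (hg : ∀ i ∈ s, ‖g i‖ ≤ 1) :
    ‖∏ i ∈ s, f i - ∏ i ∈ s, g i‖ ≤ ∑ i ∈ s, ‖f i - g i‖ := by
  classical
  induction s using Finset.induction_on with
  | empty => simp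
  | insert a s ha ih =>
    rw [Finset.prod_insert ha, Finset.prod_insert ha, Finset.sum_insert ha]
    have ih' := ih (fun i hi => hf i (Finset.mem_insert_of_mem hi))
      (fun i hi => hg i (Finset.mem_insert_of_mem hi))
    have hfp : ‖∏ i ∈ s, f i‖ ≤ 1 := by
      rw [norm_prod]
      exact Finset.prod_le_one (fun _ _ => norm_nonneg _)
        fun i hi => hf i (Finset.mem_insert_of_mem hi)
    have hga := hg a (Finset.mem_insert_self a s)
    have e : f a * ∏ i ∈ s, f i - g a * ∏ i ∈ s, g i =
        (f a - g a) * ∏ i ∈ s, f i + g a * (∏ i ∈ s, f i - ∏ i ∈ s, g i) := by ring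
    rw [e]
    refine (norm_add_le _ _).trans (add_le_add ?_ ?_)
    · rw [norm_mul]
      exact mul_le_of_le_one_right (norm_nonneg _) hfp
    · rw [norm_mul]
      exact (mul_le_of_le_one_left (norm_nonneg _) hga).trans ih'

lemma norm_exp_sub_exp_le_of_re_nonpos {z w : ℂ} (hz : z.re ≤ 0) (hw : w.re ≤ 0) :
    ‖Complex.exp z - Complex.exp w‖ ≤ ‖z - w‖ := by
  have h := (convex_halfSpace_re_le 0).norm_image_sub_le_of_norm_deriv_le
    (f := Complex.exp) (C := 1) (fun x _ => Complex.differentiableAt_exp)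
    (fun x hx => by
      rw [Complex.deriv_exp, Complex.norm_exp]
      exact Real.exp_le_one_iff.2 hx) (x := w) (y := z) hw hz
  simpa using h

lemma normSq_one_add_mul_exp_sub_one (p t : ℝ) :
    Complex.normSq (1 + (p : ℂ) * (Complex.exp (t * Complex.I) - 1)) =
      1 - 2 * (p * (1 - p)) * (1 - Real.cos t) := by
  have : 1 + (p : ℂ) * (Complex.exp (t * Complex.I) - 1) =
      ((1 + p * (Real.cos t - 1) : ℝ) : ℂ) + ((p * Real.sin t : ℝ) : ℂ) * Complex.I := by
    rw [Complex.exp_mul_I, ← Complex.ofReal_cos, ← Complex.ofReal_sin]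
    push_cast; ring
  rw [this, Complex.normSq_add_mul_I]
  linear_combination p ^ 2 * Real.sin_sq_add_cos_sq t

lemma norm_one_add_mul_exp_sub_one_le (p t : ℝ) :
    ‖1 + (p : ℂ) * (Complex.exp (t * Complex.I) - 1)‖ ≤
      Real.exp (-(p * (1 - p)) * (1 - Real.cos t)) := by
  rw [← abs_of_nonneg (norm_nonneg (1 + (p : ℂ) * (Complex.exp (t * Complex.I) - 1)))]
  refine abs_le_of_sq_le_sq ?_ (Real.exp_pos _).le
  rw [← Complex.normSq_eq_norm_sq, normSq_one_add_mul_exp_sub_one, ← Real.exp_nat_mul]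
  refine le_trans (le_of_eq ?_) (Real.add_one_le_exp _)
  push_cast; ring

lemma norm_one_add_mul_exp_sub_one_le_one {p : ℝ} (hp0 : 0 ≤ p) (hp1 : p ≤ 1) (t : ℝ) :
    ‖1 + (p : ℂ) * (Complex.exp (t * Complex.I) - 1)‖ ≤ 1 := by
  refine (norm_one_add_mul_exp_sub_one_le p t).trans (Real.exp_le_one_iff.2 ?_)
  have h1 := Real.cos_le_one t
  have : 0 ≤ p * (1 - p) * (1 - Real.cos t) :=
    mul_nonneg (mul_nonneg hp0 (by linarith)) (by linarith)
  linarith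

lemma norm_bernoulli_sub_exp_le {p t : ℝ} (hp0 : 0 ≤ p) (hp1 : p ≤ 1) (ht : |t| ≤ 1 / 2) :
    ‖1 + (p : ℂ) * (Complex.exp (t * Complex.I) - 1) - Complex.exp (p * gaussExponent t)‖ ≤
      3 * (p * |t| ^ 3) + 4 * (p ^ 2 * t ^ 2) := by
  have hu := norm_gaussExponent_le ht
  have h1 : ‖Complex.exp (t * Complex.I) - 1 - gaussExponent t‖ ≤ 3 * |t| ^ 3 := by
    have h := Complex.norm_exp_sub_sum_le_norm_mul_exp (t * Complex.I) 3
    have hn : ‖(t : ℂ) * Complex.I‖ = |t| := by simp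
    rw [hn] at h
    have e : Complex.exp (t * Complex.I) - 1 - gaussExponent t = Complex.exp (t * Complex.I) -
        ∑ m ∈ Finset.range 3, ((t : ℂ) * Complex.I) ^ m / m.factorial := by
      simp only [Finset.sum_range_succ, Finset.sum_range_zero, Nat.factorial, gaussExponent]
      push_cast
      linear_combination ((t : ℂ) ^ 2 / 2) * Complex.I_sq
    rw [e]
    refine h.trans ?_
    have h3 : Real.exp |t| ≤ 3 :=
      (Real.exp_le_exp.2 (by linarith : |t| ≤ 1)).trans Real.exp_one_lt_three.le
    nlinarith [pow_nonneg (abs_nonneg t) 3]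
  have hpu : ‖(p : ℂ) * gaussExponent t‖ ≤ p * (2 * |t|) := by
    rw [norm_mul, Complex.norm_real, Real.norm_of_nonneg hp0]
    gcongr
  have h2 : ‖Complex.exp (p * gaussExponent t) - 1 - p * gaussExponent t‖ ≤
      4 * (p ^ 2 * t ^ 2) := by
    refine (Complex.norm_exp_sub_one_sub_id_le (hpu.trans ?_)).trans ?_
    · nlinarith [abs_nonneg t]
    · calc _ ≤ (p * (2 * |t|)) ^ 2 := by gcongr
        _ = 4 * (p ^ 2 * t ^ 2) := by rw [← sq_abs t]; ring
  have e : 1 + (p : ℂ) * (Complex.exp (t * Complex.I) - 1) - Complex.exp (p * gaussExponent t) =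
      p * (Complex.exp (t * Complex.I) - 1 - gaussExponent t) -
        (Complex.exp (p * gaussExponent t) - 1 - p * gaussExponent t) := by ring
  rw [e]
  refine (norm_sub_le _ _).trans (add_le_add ?_ h2)
  rw [norm_mul, Complex.norm_real, Real.norm_of_nonneg hp0]
  nlinarith

lemma sum_range_inv_succ_sq_le (N : ℕ) :
    ∑ i ∈ Finset.range N, (1 : ℝ) / (i + 1) ^ 2 ≤ 2 := by
  have h : ∑ i ∈ Finset.range N, (1 : ℝ) / (i + 1) ^ 2 ≤ 2 - 2 / ((N : ℝ) + 1) := by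
    induction N with
    | zero => simp
    | succ N ih =>
      rw [Finset.sum_range_succ]
      have : (1 : ℝ) / (N + 1) ^ 2 ≤ 2 / (N + 1) - 2 / ((N + 1 : ℕ) + 1) := by
        push_cast
        rw [div_sub_div _ _ (by positivity) (by positivity),
          div_le_div_iff₀ (by positivity) (by positivity)]
        have : (0 : ℝ) ≤ N := N.cast_nonneg
        nlinarith [mul_nonneg this this, mul_nonneg this (mul_nonneg this this)]
      linarith
  have : (0 : ℝ) ≤ 2 / (N + 1) := by positivity
  linarith

lemma sum_sq_ewens_le {θ b : ℝ} (hθ : 0 < θ) (hb : θ ≤ b) {n : ℕ} (hn : 1 ≤ n) :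
    ∑ j ∈ Finset.range n, (θ / (θ + j)) ^ 2 ≤ 1 + 2 * b ^ 2 := by
  obtain ⟨N, rfl⟩ : ∃ N, n = N + 1 := ⟨n - 1, by omega⟩
  rw [Finset.sum_range_succ']
  have h : ∑ j ∈ Finset.range N, (θ / (θ + (j + 1 : ℕ))) ^ 2 ≤
      ∑ j ∈ Finset.range N, b ^ 2 * ((1 : ℝ) / (j + 1) ^ 2) := by
    refine Finset.sum_le_sum fun j _ => ?_
    rw [div_pow, mul_one_div]
    push_cast
    gcongr (?_ / ?_)
    · exact pow_le_pow_left₀ hθ.le hb 2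
    · exact pow_le_pow_left₀ (by positivity) (by linarith) 2
  rw [← Finset.mul_sum] at h
  have h2 := sum_range_inv_succ_sq_le N
  have h0 : (θ / (θ + ((0 : ℕ) : ℝ))) ^ 2 = 1 := by simp [hθ.ne']
  nlinarith [sq_nonneg b]

lemma abs_sum_ewens_sub_le {θ b : ℝ} (hθ : 0 < θ) (hb : θ ≤ b) {n : ℕ} (hn : 1 ≤ n) :
    |∑ j ∈ Finset.range n, θ / (θ + j) - θ * Real.log n| ≤ 1 + b + 2 * b ^ 2 := by
  obtain ⟨N, rfl⟩ : ∃ N, n = N + 1 := ⟨n - 1, by omega⟩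
  rw [Finset.sum_range_succ']
  have h0 : θ / (θ + ((0 : ℕ) : ℝ)) = 1 := by simp [hθ.ne']
  rw [h0]
  have hH : ((harmonic N : ℚ) : ℝ) = ∑ j ∈ Finset.range N, (1 : ℝ) / (j + 1) := by
    simp [harmonic]
  have hlo := log_add_one_le_harmonic N
  have hhi : ((harmonic N : ℚ) : ℝ) ≤ 1 + Real.log (N + 1 : ℕ) := by
    refine (harmonic_le_one_add_log N).trans ?_
    rcases Nat.eq_zero_or_pos N with rfl | hN
    · simp
    · gcongr
      omega
  have hd : ∀ j ∈ Finset.range N, θ / (θ + (j + 1 : ℕ)) ≤ θ * (1 / (j + 1)) ∧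
      θ * (1 / (j + 1)) - b ^ 2 * (1 / (j + 1) ^ 2) ≤ θ / (θ + (j + 1 : ℕ)) := by
    intro j _
    have hj : (0 : ℝ) < (j : ℝ) + 1 := by positivity
    push_cast
    constructor
    · rw [mul_one_div]
      gcongr θ / ?_
      linarith
    · have e : θ * (1 / (j + 1)) - θ / (θ + (j + 1)) = θ ^ 2 / ((j + 1) * (θ + (j + 1))) := by
        field_simp
        ring
      have h : θ ^ 2 / (((j : ℝ) + 1) * (θ + (j + 1))) ≤ b ^ 2 * (1 / (j + 1) ^ 2) := by
        rw [mul_one_div, sq ((j : ℝ) + 1)]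
        gcongr ?_ ^ 2 / (_ * ?_)
        linarith
      linarith
  have h1 := Finset.sum_le_sum fun j hj => (hd j hj).1
  have h2 := Finset.sum_le_sum fun j hj => (hd j hj).2
  rw [Finset.sum_sub_distrib, ← Finset.mul_sum, ← Finset.mul_sum] at h2
  rw [← Finset.mul_sum] at h1
  rw [← hH] at h1 h2
  have h3 := sum_range_inv_succ_sq_le N
  have h4 : b ^ 2 * ∑ j ∈ Finset.range N, (1 : ℝ) / (j + 1) ^ 2 ≤ b ^ 2 * 2 := by gcongr
  have h5 : θ * ((harmonic N : ℚ) : ℝ) ≤ θ * (1 + Real.log (N + 1 : ℕ)) := by gcongr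
  have h6 : θ * Real.log (N + 1 : ℕ) ≤ θ * ((harmonic N : ℚ) : ℝ) := by gcongr
  rw [abs_le]
  constructor <;> nlinarith

lemma norm_ewensCharFun_le {θ b : ℝ} (hθ : 0 < θ) (hb : θ ≤ b) {n : ℕ} (hn : 1 ≤ n) {t : ℝ}
    (ht : |t| ≤ π) :
    ‖ewensCharFun n θ t‖ ≤ Real.exp (2 * ((1 + b + 2 * b ^ 2) + (1 + 2 * b ^ 2))) *
      Real.exp (-(2 / π ^ 2 * (θ * Real.log n)) * t ^ 2) := by
  have hm := (abs_le.1 (abs_sum_ewens_sub_le hθ hb hn)).1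
  have hq := sum_sq_ewens_le hθ hb hn
  have hcos := Real.cos_le_one_sub_mul_cos_sq ht
  have hcos' := Real.neg_one_le_cos t
  have hlam : 0 ≤ θ * Real.log n := mul_nonneg hθ.le (Real.log_natCast_nonneg n)
  rw [ewensCharFun, norm_prod]
  refine (Finset.prod_le_prod (fun _ _ => norm_nonneg _)
    fun j _ => norm_one_add_mul_exp_sub_one_le _ t).trans ?_
  rw [← Real.exp_sum, ← Real.exp_add, Real.exp_le_exp, ← Finset.sum_mul, Finset.sum_neg_distrib]
  have e : ∑ j ∈ Finset.range n, θ / (θ + j) * (1 - θ / (θ + j)) =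
      ∑ j ∈ Finset.range n, θ / (θ + j) - ∑ j ∈ Finset.range n, (θ / (θ + j)) ^ 2 := by
    rw [← Finset.sum_sub_distrib]
    exact Finset.sum_congr rfl fun j _ => by ring
  rw [e]
  have h1 : θ * Real.log n - ((1 + b + 2 * b ^ 2) + (1 + 2 * b ^ 2)) ≤
      ∑ j ∈ Finset.range n, θ / (θ + j) - ∑ j ∈ Finset.range n, (θ / (θ + j)) ^ 2 := by linarith
  have h2 := mul_le_mul_of_nonneg_right h1 (sub_nonneg.2 (Real.cos_le_one t))
  have h3 : θ * Real.log n * (2 / π ^ 2 * t ^ 2) ≤ θ * Real.log n * (1 - Real.cos t) := by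
    gcongr
    linarith
  have h4 : ((1 + b + 2 * b ^ 2) + (1 + 2 * b ^ 2)) * (1 - Real.cos t) ≤
      ((1 + b + 2 * b ^ 2) + (1 + 2 * b ^ 2)) * 2 := by
    have : 0 < b := hθ.trans_le hb
    gcongr
    linarith
  linarith

lemma div_self_add_natCast_mem_Icc {θ : ℝ} (hθ : 0 < θ) (j : ℕ) :
    θ / (θ + j) ∈ Set.Icc (0 : ℝ) 1 :=
  ⟨by positivity, div_le_one_of_le₀ (by linarith [j.cast_nonneg (α := ℝ)]) (by positivity)⟩

lemma norm_ewensCharFun_le_one {θ : ℝ} (hθ : 0 < θ) (n : ℕ) (t : ℝ) :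
    ‖ewensCharFun n θ t‖ ≤ 1 := by
  rw [ewensCharFun, norm_prod]
  exact Finset.prod_le_one (fun _ _ => norm_nonneg _) fun j _ =>
    norm_one_add_mul_exp_sub_one_le_one (div_self_add_natCast_mem_Icc hθ j).1
      (div_self_add_natCast_mem_Icc hθ j).2 t

lemma norm_ewensCharFun_sub_le {θ b : ℝ} (hθ : 0 < θ) (hb : θ ≤ b) {n : ℕ} (hn : 1 ≤ n) {t : ℝ}
    (ht : |t| ≤ 1 / 2) :
    ‖ewensCharFun n θ t - Complex.exp ((θ * Real.log n : ℝ) * gaussExponent t)‖ ≤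
      3 * ((θ * Real.log n + (1 + b + 2 * b ^ 2)) * |t| ^ 3) + 4 * ((1 + 2 * b ^ 2) * t ^ 2) +
        (1 + b + 2 * b ^ 2) * (2 * |t|) := by
  have hm := abs_sum_ewens_sub_le hθ hb hn
  have hq := sum_sq_ewens_le hθ hb hn
  have hp := div_self_add_natCast_mem_Icc hθ
  set m := ∑ j ∈ Finset.range n, θ / (θ + j) with hm_def
  have hm0 : 0 ≤ m := Finset.sum_nonneg fun j _ => (hp j).1
  have hlam : 0 ≤ θ * Real.log n := mul_nonneg hθ.le (Real.log_natCast_nonneg n)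
  have hprod : Complex.exp ((m : ℝ) * gaussExponent t) =
      ∏ j ∈ Finset.range n, Complex.exp ((θ / (θ + j) : ℝ) * gaussExponent t) := by
    rw [← Complex.exp_sum, ← Finset.sum_mul, hm_def, Complex.ofReal_sum]
  have h1 : ‖ewensCharFun n θ t - Complex.exp ((m : ℝ) * gaussExponent t)‖ ≤
      3 * (m * |t| ^ 3) + 4 * ((1 + 2 * b ^ 2) * t ^ 2) := by
    rw [hprod, ewensCharFun]
    refine (norm_prod_sub_prod_le _ _ _
      (fun j _ => norm_one_add_mul_exp_sub_one_le_one (hp j).1 (hp j).2 t)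
      (fun j _ => norm_exp_mul_gaussExponent_le_one (hp j).1 t)).trans ?_
    refine (Finset.sum_le_sum fun j _ =>
      norm_bernoulli_sub_exp_le (hp j).1 (hp j).2 ht).trans ?_
    rw [Finset.sum_add_distrib, ← Finset.mul_sum, ← Finset.mul_sum, ← Finset.sum_mul,
      ← Finset.sum_mul]
    gcongr
  have hre : ∀ c : ℝ, 0 ≤ c → ((c : ℂ) * gaussExponent t).re ≤ 0 := by
    intro c hc
    rw [Complex.re_ofReal_mul, gaussExponent_re]
    have : 0 ≤ c * (t ^ 2 / 2) := by positivity
    linarith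
  have h2 : ‖Complex.exp ((m : ℝ) * gaussExponent t) -
      Complex.exp ((θ * Real.log n : ℝ) * gaussExponent t)‖ ≤
      (1 + b + 2 * b ^ 2) * (2 * |t|) := by
    refine (norm_exp_sub_exp_le_of_re_nonpos (hre m hm0) (hre _ hlam)).trans ?_
    rw [← sub_mul, ← Complex.ofReal_sub, norm_mul, Complex.norm_real, Real.norm_eq_abs]
    have := norm_gaussExponent_le ht
    have hb0 := hθ.trans_le hb
    gcongr
  have h3 : m * |t| ^ 3 ≤ (θ * Real.log n + (1 + b + 2 * b ^ 2)) * |t| ^ 3 := by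
    gcongr
    linarith [(abs_le.1 hm).2]
  refine (norm_sub_le_norm_sub_add_norm_sub _ (Complex.exp ((m : ℝ) * gaussExponent t)) _).trans ?_
  linarith

/-- A common majorant of the deviations between the characteristic functions and their Gaussian
approximations, at variance scale `ℓ`. -/
noncomputable def charFunMajorant (C c ℓ t : ℝ) : ℝ :=
  min (C * (ℓ * |t| ^ 3 + |t| + t ^ 2)) (C * Real.exp (-c * (ℓ * t ^ 2)))

lemma charFunMajorant_nonneg {C c ℓ : ℝ} (hC : 0 ≤ C) (hℓ : 0 ≤ ℓ) (t : ℝ) :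
    0 ≤ charFunMajorant C c ℓ t :=
  le_min (by positivity) (by positivity)

lemma continuous_charFunMajorant (C c ℓ : ℝ) : Continuous (charFunMajorant C c ℓ) := by
  unfold charFunMajorant
  fun_prop

lemma integrable_charFunMajorant {C c ℓ : ℝ} (hC : 0 ≤ C) (hc : 0 < c) (hℓ : 0 < ℓ) :
    MeasureTheory.Integrable (charFunMajorant C c ℓ) := by
  refine ((integrable_exp_neg_mul_sq (mul_pos hc hℓ)).const_mul C).mono'
    (continuous_charFunMajorant C c ℓ).aestronglyMeasurable (.of_forall fun t => ?_)
  rw [Real.norm_of_nonneg (charFunMajorant_nonneg hC hℓ.le t)]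
  refine (min_le_right _ _).trans (le_of_eq ?_)
  ring_nf

lemma tendsto_sqrt_mul_integral_charFunMajorant {C c : ℝ} (hC : 0 ≤ C) (hc : 0 < c) :
    Tendsto (fun ℓ : ℝ => Real.sqrt ℓ * ∫ t, charFunMajorant C c ℓ t) atTop (nhds 0) := by
  have h : Tendsto (fun ℓ : ℝ => ∫ s, charFunMajorant C c ℓ (s / Real.sqrt ℓ)) atTop
      (nhds (∫ _ : ℝ, (0 : ℝ))) := by
    refine MeasureTheory.tendsto_integral_filter_of_dominated_convergence
      (fun s => C * Real.exp (-c * s ^ 2)) (.of_forall fun ℓ => ?_) ?_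
      ((integrable_exp_neg_mul_sq hc).const_mul C) (.of_forall fun s => ?_)
    · exact ((continuous_charFunMajorant C c ℓ).comp
        (continuous_id.div_const _)).aestronglyMeasurable
    · filter_upwards [eventually_gt_atTop 0] with ℓ hℓ
      refine .of_forall fun s => ?_
      rw [Real.norm_of_nonneg (charFunMajorant_nonneg hC hℓ.le _)]
      refine (min_le_right _ _).trans (le_of_eq ?_)
      rw [div_pow, Real.sq_sqrt hℓ.le, mul_div_cancel₀ _ hℓ.ne']
    · have hr : Tendsto (fun ℓ : ℝ => (Real.sqrt ℓ)⁻¹) atTop (nhds 0) :=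
        tendsto_inv_atTop_zero.comp Real.tendsto_sqrt_atTop
      have hlim : Tendsto (fun ℓ : ℝ => C * (|s| ^ 3 * (Real.sqrt ℓ)⁻¹ + |s| * (Real.sqrt ℓ)⁻¹ +
          s ^ 2 * ((Real.sqrt ℓ)⁻¹) ^ 2)) atTop (nhds 0) := by
        have := (((hr.const_mul (|s| ^ 3)).add (hr.const_mul |s|)).add
          ((hr.pow 2).const_mul (s ^ 2))).const_mul C
        simpa using this
      refine squeeze_zero' ?_ ?_ hlim
      · filter_upwards [eventually_ge_atTop 0] with ℓ hℓ using charFunMajorant_nonneg hC hℓ _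
      · filter_upwards [eventually_gt_atTop 0] with ℓ hℓ
        refine (min_le_left _ _).trans (le_of_eq ?_)
        have hs : 0 < Real.sqrt ℓ := Real.sqrt_pos.2 hℓ
        rw [abs_div, abs_of_pos hs]
        nth_rewrite 1 [← Real.sq_sqrt hℓ.le]
        field_simp
  rw [MeasureTheory.integral_zero] at h
  refine h.congr' ?_
  filter_upwards [eventually_gt_atTop 0] with ℓ hℓ
  rw [MeasureTheory.Measure.integral_comp_div (charFunMajorant C c ℓ), abs_of_nonneg
    (Real.sqrt_nonneg ℓ), smul_eq_mul]

lemma exists_norm_charFun_sub_le_majorant {a b : ℝ} (ha : 0 < a) (hab : a ≤ b) :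
    ∃ C c : ℝ, 0 ≤ C ∧ 0 < c ∧ ∀ (n : ℕ) (θ t : ℝ), 1 ≤ Real.log n → θ ∈ Set.Icc a b →
      ‖(Set.Ioc (-π) π).indicator (ewensCharFun n θ) t -
        Complex.exp ((θ * Real.log n : ℝ) * gaussExponent t)‖ ≤
          charFunMajorant C c (Real.log n) t := by
  have hb : 0 < b := ha.trans_le hab
  set M := 1 + b + 2 * b ^ 2 with hM
  set Q := 1 + 2 * b ^ 2 with hQ
  have hM0 : 0 < M := by positivity
  have hQ0 : 0 < Q := by positivity
  set E := Real.exp (2 * (M + Q)) with hE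
  have hE0 : 0 < E := Real.exp_pos _
  refine ⟨16 + 3 * (b + M) + 4 * Q + 2 * M + E, 2 / π ^ 2 * a, by positivity, by positivity, ?_⟩
  intro n θ t hℓ hθ
  have hθ0 : 0 < θ := ha.trans_le hθ.1
  have hn : 1 ≤ n := by
    rcases Nat.eq_zero_or_pos n with rfl | h
    · simp at hℓ; linarith
    · exact h
  set ℓ := Real.log n with hℓ_def
  have hlam : 0 ≤ θ * ℓ := by positivity
  have hind : ‖(Set.Ioc (-π) π).indicator (ewensCharFun n θ) t‖ ≤
      E * Real.exp (-(2 / π ^ 2 * a) * (ℓ * t ^ 2)) := by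
    by_cases ht : t ∈ Set.Ioc (-π) π
    · rw [Set.indicator_of_mem ht]
      refine (norm_ewensCharFun_le hθ0 hθ.2 hn (abs_le.2 ⟨ht.1.le, ht.2⟩)).trans ?_
      gcongr E * Real.exp ?_
      have : 2 / π ^ 2 * (a * ℓ) * t ^ 2 ≤ 2 / π ^ 2 * (θ * ℓ) * t ^ 2 := by
        gcongr
        exact hθ.1
      linarith
    · rw [Set.indicator_of_notMem ht, norm_zero]
      positivity
  refine le_min ?_ ?_
  · have ht3 : 0 ≤ |t| ^ 3 := by positivity
    have hℓt : |t| ^ 3 ≤ ℓ * |t| ^ 3 := le_mul_of_one_le_left ht3 hℓ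
    by_cases ht : |t| ≤ 1 / 2
    · have hmem : t ∈ Set.Ioc (-π) π := by
        have := Real.pi_gt_three
        constructor <;> linarith [abs_le.1 ht]
      rw [Set.indicator_of_mem hmem]
      refine (norm_ewensCharFun_sub_le hθ0 hθ.2 hn ht).trans ?_
      rw [← hM, ← hQ, ← hℓ_def]
      have h1 : θ * ℓ * |t| ^ 3 ≤ b * ℓ * |t| ^ 3 := by gcongr; exact hθ.2
      have h2 : M * |t| ^ 3 ≤ M * (ℓ * |t| ^ 3) := by gcongr
      have hR1 : 0 ≤ (16 + 4 * Q + 2 * M + E) * (ℓ * |t| ^ 3) := by positivity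
      have hR2 : 0 ≤ (16 + 3 * (b + M) + 4 * Q + E) * |t| := by positivity
      have hR3 : 0 ≤ (16 + 3 * (b + M) + 2 * M + E) * t ^ 2 := by positivity
      linarith
    · push Not at ht
      have h8 : (1 / 2 : ℝ) ^ 3 ≤ |t| ^ 3 := by gcongr
      have h1 : ‖(Set.Ioc (-π) π).indicator (ewensCharFun n θ) t‖ ≤ 1 :=
        (norm_indicator_le_norm_self _ _).trans (norm_ewensCharFun_le_one hθ0 n t)
      have h2 := norm_exp_mul_gaussExponent_le_one hlam t
      refine (norm_sub_le _ _).trans ?_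
      have hR1 : 0 ≤ (3 * (b + M) + 4 * Q + 2 * M + E) * (ℓ * |t| ^ 3) := by positivity
      have hR2 : 0 ≤ (16 + 3 * (b + M) + 4 * Q + 2 * M + E) * (|t| + t ^ 2) := by positivity
      linarith
  · have hg : ‖Complex.exp ((θ * ℓ : ℝ) * gaussExponent t)‖ ≤
        1 * Real.exp (-(2 / π ^ 2 * a) * (ℓ * t ^ 2)) := by
      rw [norm_exp_mul_gaussExponent, one_mul, Real.exp_le_exp]
      have hpi : 2 / π ^ 2 ≤ 1 / 2 := by
        rw [div_le_div_iff₀ (by positivity) two_pos]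
        nlinarith [Real.pi_gt_three]
      have : 2 / π ^ 2 * (a * ℓ * t ^ 2) ≤ 1 / 2 * (θ * ℓ * t ^ 2) := by
        gcongr
        exact hθ.1
      linarith
    refine (norm_sub_le _ _).trans ((add_le_add hind hg).trans ?_)
    rw [← add_mul]
    have : 0 ≤ 3 * (b + M) + 4 * Q + 2 * M := by positivity
    exact mul_le_mul_of_nonneg_right (by linarith) (Real.exp_pos _).le

lemma abs_ewensPMF_sub_le {n k : ℕ} {θ C c : ℝ} (hθ : 0 < θ) (hk : k ≤ n) (hn : 0 < Real.log n)
    (hC : 0 ≤ C) (hc : 0 < c)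
    (h : ∀ t, ‖(Set.Ioc (-π) π).indicator (ewensCharFun n θ) t -
        Complex.exp ((θ * Real.log n : ℝ) * gaussExponent t)‖ ≤
          charFunMajorant C c (Real.log n) t) :
    |ewensPMF n θ k - Real.exp (-(xnorm n k θ) ^ 2 / 2) / Real.sqrt (2 * π * θ * Real.log n)| ≤
      ∫ t, charFunMajorant C c (Real.log n) t := by
  have hlam : 0 < θ * Real.log n := mul_pos hθ hn
  set d := ewensPMF n θ k -
    Real.exp (-(xnorm n k θ) ^ 2 / 2) / Real.sqrt (2 * π * θ * Real.log n) with hd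
  have hpi := Real.pi_gt_three
  have hcont : Continuous fun t : ℝ =>
      ewensCharFun n θ t * Complex.exp (-k * (t * Complex.I)) := by
    have := continuous_ewensCharFun n θ
    fun_prop
  have hnorm : ∀ t : ℝ, ‖Complex.exp (-k * (t * Complex.I))‖ = 1 := by
    intro t
    simp [Complex.norm_exp]
  have h1 := ewensPMF_eq_integral hθ hk
  rw [intervalIntegral.integral_of_le (by linarith),
    ← MeasureTheory.integral_indicator measurableSet_Ioc] at h1
  have hI : MeasureTheory.Integrable ((Set.Ioc (-π) π).indicator fun t : ℝ =>
      ewensCharFun n θ t * Complex.exp (-k * (t * Complex.I))) :=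
    (hcont.integrableOn_Ioc).integrable_indicator measurableSet_Ioc
  have h2 := integral_gaussExponent hlam k
  have key : ((2 * π * d : ℝ) : ℂ) = ∫ t : ℝ, ((Set.Ioc (-π) π).indicator (ewensCharFun n θ) t -
        Complex.exp ((θ * Real.log n : ℝ) * gaussExponent t)) *
        Complex.exp (-k * (t * Complex.I)) := by
    have e : ∀ t : ℝ, (Set.Ioc (-π) π).indicator (ewensCharFun n θ) t *
        Complex.exp (-k * (t * Complex.I)) = (Set.Ioc (-π) π).indicator (fun t : ℝ =>
          ewensCharFun n θ t * Complex.exp (-k * (t * Complex.I))) t := fun t =>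
      (Set.indicator_mul_left _ _ fun t : ℝ => Complex.exp (-k * (t * Complex.I))).symm
    simp_rw [sub_mul, e]
    rw [MeasureTheory.integral_sub hI (integrable_gaussExponent hlam k), ← h1, h2, hd, xnorm,
      mul_assoc (2 * π) θ]
    push_cast
    ring
  have hle : |2 * π * d| ≤ ∫ t, charFunMajorant C c (Real.log n) t := by
    rw [← Real.norm_eq_abs, ← Complex.norm_real, key]
    refine MeasureTheory.norm_integral_le_of_norm_le (integrable_charFunMajorant hC hc hn)
      (.of_forall fun t => ?_)
    rw [norm_mul, hnorm, mul_one]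
    exact h t
  refine le_trans ?_ hle
  rw [abs_mul, abs_of_pos (by positivity : 0 < 2 * π)]
  exact le_mul_of_one_le_left (abs_nonneg d) (by linarith)

lemma IsCompact.exists_subset_Icc_pos {L : Set ℝ} (hL : IsCompact L) (hLpos : L ⊆ Set.Ioi 0) :
    ∃ a b : ℝ, 0 < a ∧ a ≤ b ∧ L ⊆ Set.Icc a b := by
  rcases L.eq_empty_or_nonempty with rfl | hne
  · exact ⟨1, 1, one_pos, le_rfl, Set.empty_subset _⟩
  · obtain ⟨a, ha⟩ := hL.exists_isLeast hne
    obtain ⟨b, hb⟩ := hL.exists_isGreatest hne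
    exact ⟨a, b, hLpos ha.1, ha.2 hb.1, fun x hx => ⟨ha.2 hx, hb.2 hx⟩⟩

/-- Uniform local CLT for the Ewens distribution (r = 0 case of the Edgeworth expansion). -/
theorem ewens_local_clt (L : Set ℝ) (hL : IsCompact L) (hLpos : L ⊆ Set.Ioi (0 : ℝ)) :
    Tendsto (fun n : ℕ =>
      Real.sqrt (Real.log n) *
        sSup {y : ℝ | ∃ θ ∈ L, ∃ k ∈ Finset.Icc 1 n,
          y = |ewensPMF n θ k -
            Real.exp (-(xnorm n k θ) ^ 2 / 2) / Real.sqrt (2 * π * θ * Real.log n)|})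
      atTop (nhds 0) := by
  obtain ⟨a, b, ha, hab, hLab⟩ := hL.exists_subset_Icc_pos hLpos
  obtain ⟨C, c, hC, hc, h⟩ := exists_norm_charFun_sub_le_majorant ha hab
  have hlog : Tendsto (fun n : ℕ => Real.log n) atTop atTop :=
    Real.tendsto_log_atTop.comp tendsto_natCast_atTop_atTop
  refine squeeze_zero' (.of_forall fun n => ?_) ?_
    ((tendsto_sqrt_mul_integral_charFunMajorant hC hc).comp hlog)
  · refine mul_nonneg (Real.sqrt_nonneg _) (Real.sSup_nonneg ?_)
    rintro y ⟨θ, -, k, -, rfl⟩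
    exact abs_nonneg _
  · filter_upwards [hlog.eventually_ge_atTop 1] with n hn
    refine mul_le_mul_of_nonneg_left (Real.sSup_le ?_ ?_) (Real.sqrt_nonneg _)
    · rintro y ⟨θ, hθ, k, hk, rfl⟩
      exact abs_ewensPMF_sub_le (hLpos hθ) (Finset.mem_Icc.1 hk).2 (by linarith) hC hc
        fun t => h n θ t hn (hLab hθ)
    · exact MeasureTheory.integral_nonneg fun t => charFunMajorant_nonneg hC (by linarith) t
end

section
/- Fix a compact set L ⊂ (0,∞). Define H₁(x,θ) = −θψ(θ)·x + (x³ − 3x)/6, where ψ is the digamma function. Then (log n) · sup_{θ∈L} max_{1≤k≤n} | L_n(θ,k) − (e^{−x_n(k,θ)²/2}/√(2π θ log n)) · (1 + H₁(x_n(k,θ),θ)/√(θ log n)) | tends to 0 as n → ∞. (This is the r = 1 case of the Edgeworth expansion for the Ewens distribution.) -/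
open Real Filter

/-- The digamma function `ψ(θ) = Γ′(θ)/Γ(θ)`, the derivative of `log ∘ Γ`. -/
noncomputable def digamma (θ : ℝ) : ℝ := deriv (fun x => Real.log (Real.Gamma x)) θ

/-- The first Edgeworth polynomial `H₁(x,θ) = −θψ(θ)x + (x³ − 3x)/6`. -/
noncomputable def H₁ (x θ : ℝ) : ℝ := -θ * digamma θ * x + (x ^ 3 - 3 * x) / 6

lemma differentiableAt_log_Gamma {θ : ℝ} (hθ : 0 < θ) :
    DifferentiableAt ℝ (fun x => Real.log (Real.Gamma x)) θ := by
  refine (Real.differentiableAt_Gamma fun m => ?_).log (Real.Gamma_pos_of_pos hθ).ne'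
  have : (0 : ℝ) ≤ m := m.cast_nonneg
  linarith

lemma log_Gamma_add_one {θ : ℝ} (hθ : 0 < θ) :
    Real.log (Real.Gamma (θ + 1)) = Real.log θ + Real.log (Real.Gamma θ) := by
  rw [Real.Gamma_add_one hθ.ne', Real.log_mul hθ.ne' (Real.Gamma_pos_of_pos hθ).ne']

lemma digamma_add_one {θ : ℝ} (hθ : 0 < θ) : digamma (θ + 1) = 1 / θ + digamma θ := by
  unfold digamma
  rw [← deriv_comp_add_const (f := fun x => Real.log (Real.Gamma x))]
  have h : (fun x => Real.log (Real.Gamma (x + 1))) =ᶠ[nhds θ]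
      fun x => Real.log x + Real.log (Real.Gamma x) := by
    filter_upwards [lt_mem_nhds hθ] with x hx using log_Gamma_add_one hx
  rw [h.deriv_eq, deriv_fun_add (Real.differentiableAt_log hθ.ne') (differentiableAt_log_Gamma hθ),
    Real.deriv_log, one_div]

lemma digamma_add_nat {θ : ℝ} (hθ : 0 < θ) (n : ℕ) :
    digamma (θ + n) = ∑ j ∈ Finset.range n, 1 / (θ + j) + digamma θ := by
  induction n with
  | zero => simp
  | succ n ih =>
    have : (0 : ℝ) < θ + n := by positivity
    rw [Nat.cast_succ, ← add_assoc, digamma_add_one this, ih, Finset.sum_range_succ]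
    ring

lemma digamma_le_log {θ : ℝ} (hθ : 0 < θ) : digamma θ ≤ Real.log θ := by
  have h := Real.convexOn_log_Gamma.deriv_le_slope (x := θ) (y := θ + 1) hθ
    (Set.mem_Ioi.2 (by linarith)) (by linarith) (differentiableAt_log_Gamma hθ)
  simp only [slope_def_field, Function.comp_apply, log_Gamma_add_one hθ, add_sub_cancel_left,
    add_sub_cancel_right, div_one] at h
  exact h

lemma log_sub_le_digamma {θ : ℝ} (hθ : 0 < θ) : Real.log θ - 1 / θ ≤ digamma θ := by
  have hθ' : 0 < θ + 1 := by linarith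
  have h := Real.convexOn_log_Gamma.slope_le_deriv (x := θ) (y := θ + 1) hθ
    hθ' (by linarith) (differentiableAt_log_Gamma hθ')
  simp only [slope_def_field, Function.comp_apply, log_Gamma_add_one hθ, add_sub_cancel_left,
    add_sub_cancel_right, div_one] at h
  have h2 := digamma_add_one hθ
  unfold digamma at h2 ⊢
  have h3 : Real.log θ ≤ deriv (fun x => Real.log (Real.Gamma x)) (θ + 1) := h
  linarith

lemma abs_mul_digamma_le {θ : ℝ} (hθ : 0 < θ) : |θ * digamma θ| ≤ θ ^ 2 + 2 := by
  have h1 := mul_le_mul_of_nonneg_left (digamma_le_log hθ) hθ.le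
  have h2 := mul_le_mul_of_nonneg_left (log_sub_le_digamma hθ) hθ.le
  have h3 := mul_le_mul_of_nonneg_left (Real.log_le_sub_one_of_pos hθ) hθ.le
  have h4 := mul_le_mul_of_nonneg_left (Real.one_sub_inv_le_log_of_pos hθ) hθ.le
  rw [mul_sub, mul_inv_cancel₀ hθ.ne'] at h4
  rw [mul_sub, mul_one_div_cancel hθ.ne'] at h2
  rw [abs_le]
  constructor <;> nlinarith

lemma abs_sum_div_add_sub_le {θ : ℝ} (hθ : 0 < θ) {n : ℕ} (hn : 0 < n) :
    |∑ j ∈ Finset.range n, θ / (θ + j) - (θ * Real.log n - θ * digamma θ)| ≤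
      θ * (θ + 1) / n := by
  have hn' : (0 : ℝ) < n := Nat.cast_pos.2 hn
  have hs : ∑ j ∈ Finset.range n, θ / (θ + j) = θ * (digamma (θ + n) - digamma θ) := by
    rw [digamma_add_nat hθ, add_sub_cancel_right, Finset.mul_sum]
    exact Finset.sum_congr rfl fun j _ => by rw [mul_one_div]
  have hp : 0 < θ + n := by positivity
  have h1 := digamma_le_log hp
  have h2 := log_sub_le_digamma hp
  have h3 : Real.log (θ + n) - Real.log n ≤ θ / n := by
    rw [← Real.log_div hp.ne' hn'.ne']
    refine (Real.log_le_sub_one_of_pos (by positivity)).trans (le_of_eq ?_)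
    field_simp
    ring
  have h4 : Real.log n ≤ Real.log (θ + n) := Real.log_le_log hn' (by linarith)
  have h5 : 1 / (θ + n) ≤ 1 / n := one_div_le_one_div_of_le hn' (by linarith)
  have h6 : 0 < 1 / (n : ℝ) := by positivity
  have h7 : 0 < θ / (n : ℝ) := by positivity
  have e : ∑ j ∈ Finset.range n, θ / (θ + j) - (θ * Real.log n - θ * digamma θ) =
      θ * (digamma (θ + n) - Real.log n) := by rw [hs]; ring
  rw [e, abs_mul, abs_of_pos hθ, mul_div_assoc, add_div]
  refine mul_le_mul_of_nonneg_left ?_ hθ.le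
  rw [abs_le]
  constructor <;> linarith

lemma sum_div_add_sq_le {θ : ℝ} (hθ : 0 < θ) (n : ℕ) :
    ∑ j ∈ Finset.range n, (θ / (θ + j)) ^ 2 ≤ 1 + θ := by
  suffices h : ∀ n : ℕ, ∑ j ∈ Finset.range (n + 1), (θ / (θ + j)) ^ 2 ≤ 1 + θ - θ ^ 2 / (θ + n) by
    refine (Finset.sum_le_sum_of_subset_of_nonneg (Finset.range_subset_range.2 n.le_succ)
      fun _ _ _ => sq_nonneg _).trans ((h n).trans ?_)
    have : 0 ≤ θ ^ 2 / (θ + n) := by positivity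
    linarith
  intro n
  induction n with
  | zero => simp [hθ.ne', sq]
  | succ n ih =>
    rw [Finset.sum_range_succ]
    have hp : 0 < θ + n := by positivity
    have hq : 0 < θ + (n + 1) := by positivity
    have : (θ / (θ + (n + 1))) ^ 2 ≤ θ ^ 2 / (θ + n) - θ ^ 2 / (θ + (n + 1)) := by
      rw [div_sub_div _ _ hp.ne' hq.ne', div_pow, div_le_div_iff₀ (by positivity) (by positivity)]
      nlinarith [mul_pos (pow_pos hθ 2) hq]
    push_cast
    linarith

lemma norm_prod_sub_prod_le_s1 {ι : Type*} (s : Finset ι) (a b : ι → ℂ) (m : ι → ℝ)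
    (hm : ∀ i ∈ s, 0 < m i) (ha : ∀ i ∈ s, ‖a i‖ ≤ m i) (hb : ∀ i ∈ s, ‖b i‖ ≤ m i) :
    ‖∏ i ∈ s, a i - ∏ i ∈ s, b i‖ ≤ (∏ i ∈ s, m i) * ∑ i ∈ s, ‖a i - b i‖ / m i := by
  classical
  induction s using Finset.induction_on with
  | empty => simp
  | insert i s hi ih =>
    have ih' := ih (fun j hj => hm j (Finset.mem_insert_of_mem hj))
      (fun j hj => ha j (Finset.mem_insert_of_mem hj))
      (fun j hj => hb j (Finset.mem_insert_of_mem hj))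
    have hmi := hm i (Finset.mem_insert_self i s)
    have hprod : ‖∏ j ∈ s, b j‖ ≤ ∏ j ∈ s, m j := by
      rw [norm_prod]
      exact Finset.prod_le_prod (fun _ _ => norm_nonneg _)
        fun j hj => hb j (Finset.mem_insert_of_mem hj)
    rw [Finset.prod_insert hi, Finset.prod_insert hi, Finset.prod_insert hi, Finset.sum_insert hi]
    have e : a i * ∏ j ∈ s, a j - b i * ∏ j ∈ s, b j =
        a i * (∏ j ∈ s, a j - ∏ j ∈ s, b j) + (a i - b i) * ∏ j ∈ s, b j := by ring
    rw [e]
    refine (norm_add_le _ _).trans ?_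
    rw [norm_mul, norm_mul]
    have h1 : ‖a i‖ * ‖∏ j ∈ s, a j - ∏ j ∈ s, b j‖ ≤
        m i * ((∏ j ∈ s, m j) * ∑ j ∈ s, ‖a j - b j‖ / m j) :=
      mul_le_mul (ha i (Finset.mem_insert_self i s)) ih' (norm_nonneg _) hmi.le
    have h2 : ‖a i - b i‖ * ‖∏ j ∈ s, b j‖ ≤ ‖a i - b i‖ * ∏ j ∈ s, m j :=
      mul_le_mul_of_nonneg_left hprod (norm_nonneg _)
    have e2 : m i * (∏ j ∈ s, m j) * (‖a i - b i‖ / m i + ∑ j ∈ s, ‖a j - b j‖ / m j) =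
        m i * ((∏ j ∈ s, m j) * ∑ j ∈ s, ‖a j - b j‖ / m j) +
          ‖a i - b i‖ * ∏ j ∈ s, m j := by
      field_simp
      ring
    linarith

lemma norm_cexp_sub_one_sub_id_le (z : ℂ) :
    ‖Complex.exp z - 1 - z‖ ≤ ‖z‖ ^ 2 * (Real.exp z.re + 2) := by
  have hpos := Real.exp_pos z.re
  rcases le_total ‖z‖ 1 with h | h
  · refine (Complex.norm_exp_sub_one_sub_id_le h).trans ?_
    exact le_mul_of_one_le_right (sq_nonneg _) (by linarith)
  · have h1 : ‖Complex.exp z - 1 - z‖ ≤ Real.exp z.re + 1 + ‖z‖ := by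
      refine (norm_sub_le _ _).trans ?_
      gcongr
      refine (norm_sub_le _ _).trans ?_
      rw [Complex.norm_exp, norm_one]
    have h2 : ‖z‖ ≤ ‖z‖ ^ 2 := by nlinarith
    have h3 : 1 ≤ ‖z‖ ^ 2 := by nlinarith
    nlinarith

lemma cexp_mul_I_sub_one_re (t : ℝ) : (Complex.exp (t * Complex.I) - 1).re = -(1 - Real.cos t) := by
  simp [Complex.exp_ofReal_mul_I_re]

lemma norm_cexp_mul_I_sub_one_le (t : ℝ) : ‖Complex.exp (t * Complex.I) - 1‖ ≤ |t| := by
  have := Real.norm_exp_I_mul_ofReal_sub_one_le (x := t)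
  rwa [mul_comm, Real.norm_eq_abs] at this

lemma norm_one_add_mul_cexp_sub_one_le {p : ℝ} (t : ℝ) :
    ‖1 + (p : ℂ) * (Complex.exp (t * Complex.I) - 1)‖ ≤
      Real.exp (-(p * (1 - p) * (1 - Real.cos t))) := by
  have h : ‖1 + (p : ℂ) * (Complex.exp (t * Complex.I) - 1)‖ ^ 2 =
      -(2 * (p * (1 - p) * (1 - Real.cos t))) + 1 := by
    rw [Complex.sq_norm, Complex.normSq_apply]
    simp [Complex.exp_ofReal_mul_I_re, Complex.exp_ofReal_mul_I_im]
    linear_combination p ^ 2 * Real.sin_sq_add_cos_sq t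
  have h2 := Real.add_one_le_exp (-(2 * (p * (1 - p) * (1 - Real.cos t))))
  refine le_of_sq_le_sq ?_ (Real.exp_pos _).le
  rw [h, ← Real.exp_nat_mul]
  refine h2.trans (le_of_eq ?_)
  congr 1
  push_cast
  ring

/-- Comparison of the characteristic function of a sum of independent Bernoulli variables with
that of the Poisson variable of the same mean. -/
lemma norm_prod_sub_cexp_sum_le {ι : Type*} (s : Finset ι) (p : ι → ℝ)
    (hp0 : ∀ i ∈ s, 0 ≤ p i) (hp1 : ∀ i ∈ s, p i ≤ 1) (t : ℝ) :
    ‖∏ i ∈ s, (1 + (p i : ℂ) * (Complex.exp (t * Complex.I) - 1)) -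
        Complex.exp ((∑ i ∈ s, p i : ℝ) * (Complex.exp (t * Complex.I) - 1))‖ ≤
      3 * Real.exp 1 * (∑ i ∈ s, p i ^ 2) * Real.exp (2 * ∑ i ∈ s, p i ^ 2) * t ^ 2 *
        Real.exp (-((∑ i ∈ s, p i) * (1 - Real.cos t))) := by
  set u := Complex.exp (t * Complex.I) - 1 with hu
  have hc0 : 0 ≤ 1 - Real.cos t := by linarith [Real.cos_le_one t]
  have hc2 : 1 - Real.cos t ≤ 2 := by linarith [Real.neg_one_le_cos t]
  have hure : u.re = -(1 - Real.cos t) := cexp_mul_I_sub_one_re t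
  have hun : ‖u‖ ^ 2 ≤ t ^ 2 := by
    rw [← sq_abs t]
    exact pow_le_pow_left₀ (norm_nonneg _) (norm_cexp_mul_I_sub_one_le t) 2
  set m : ι → ℝ := fun i => Real.exp (-(p i * (1 - p i) * (1 - Real.cos t))) with hm
  have hb : Complex.exp ((∑ i ∈ s, p i : ℝ) * u) = ∏ i ∈ s, Complex.exp (p i * u) := by
    rw [← Complex.exp_sum, ← Finset.sum_mul]
    push_cast
    rfl
  have hre : ∀ i, ((p i : ℂ) * u).re = -(p i * (1 - Real.cos t)) := fun i => by
    rw [Complex.re_ofReal_mul, hure]; ring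
  have key := norm_prod_sub_prod_le_s1 s (fun i => 1 + (p i : ℂ) * u)
    (fun i => Complex.exp (p i * u)) m (fun i _ => Real.exp_pos _)
    (fun i hi => norm_one_add_mul_cexp_sub_one_le t)
    (fun i hi => by
      rw [Complex.norm_exp, hre]
      refine Real.exp_le_exp.2 (neg_le_neg (mul_le_mul_of_nonneg_right ?_ hc0))
      nlinarith [hp0 i hi])
  rw [hb]
  refine key.trans ?_
  have hprod : ∏ i ∈ s, m i ≤
      Real.exp (2 * ∑ i ∈ s, p i ^ 2) * Real.exp (-((∑ i ∈ s, p i) * (1 - Real.cos t))) := by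
    rw [hm, ← Real.exp_sum, ← Real.exp_add]
    refine Real.exp_le_exp.2 ?_
    rw [Finset.mul_sum, Finset.sum_mul, ← Finset.sum_neg_distrib, ← Finset.sum_add_distrib]
    refine Finset.sum_le_sum fun i hi => ?_
    nlinarith [mul_nonneg (sq_nonneg (p i)) (sub_nonneg.2 hc2)]
  have hsum : ∑ i ∈ s, ‖1 + (p i : ℂ) * u - Complex.exp (p i * u)‖ / m i ≤
      3 * Real.exp 1 * (∑ i ∈ s, p i ^ 2) * t ^ 2 := by
    rw [Finset.mul_sum, Finset.sum_mul]
    refine Finset.sum_le_sum fun i hi => ?_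
    rw [div_le_iff₀ (Real.exp_pos _)]
    have h1 : ‖1 + (p i : ℂ) * u - Complex.exp (p i * u)‖ ≤ 3 * p i ^ 2 * t ^ 2 := by
      have h := norm_cexp_sub_one_sub_id_le (p i * u)
      have e : ‖1 + (p i : ℂ) * u - Complex.exp (p i * u)‖ =
          ‖Complex.exp (p i * u) - 1 - p i * u‖ := by
        rw [← norm_neg]; congr 1; ring
      have h3 : Real.exp ((p i : ℂ) * u).re ≤ 1 := by
        rw [hre]
        exact Real.exp_le_one_iff.2 (neg_nonpos.2 (mul_nonneg (hp0 i hi) hc0))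
      rw [e]
      refine h.trans ?_
      rw [norm_mul, Complex.norm_real, mul_pow, Real.norm_eq_abs, sq_abs]
      have : p i ^ 2 * ‖u‖ ^ 2 ≤ p i ^ 2 * t ^ 2 := mul_le_mul_of_nonneg_left hun (sq_nonneg _)
      have h0 : 0 ≤ p i ^ 2 * ‖u‖ ^ 2 := by positivity
      nlinarith
    have h2 : 1 ≤ Real.exp 1 * m i := by
      rw [hm, ← Real.exp_add]
      refine Real.one_le_exp ?_
      have hq : p i * (1 - p i) ≤ 1 / 4 := by nlinarith [sq_nonneg (p i - 1 / 2)]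
      have hq0 : 0 ≤ p i * (1 - p i) := mul_nonneg (hp0 i hi) (by linarith [hp1 i hi])
      nlinarith
    calc _ ≤ 3 * p i ^ 2 * t ^ 2 * 1 := by rw [mul_one]; exact h1
      _ ≤ 3 * p i ^ 2 * t ^ 2 * (Real.exp 1 * m i) :=
        mul_le_mul_of_nonneg_left h2 (by positivity)
      _ = _ := by ring
  refine (mul_le_mul hprod hsum (Finset.sum_nonneg fun i _ => by positivity)
    (by positivity)).trans (le_of_eq ?_)
  ring

/-- The Fourier transform, centred at `l`, of the first order Edgeworth approximation of variance
`l` with drift coefficient `a`. -/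
noncomputable def edgeworthChar (l a t : ℝ) : ℂ :=
  Complex.exp (-(l * t ^ 2 / 2 : ℝ)) *
    (1 + a * (t * Complex.I) + l * (t * Complex.I) ^ 3 / 6)

lemma norm_cexp_neg_half_le {l : ℝ} (hl : 0 ≤ l) (t : ℝ) :
    ‖Complex.exp (-(l * t ^ 2 / 2 : ℝ))‖ ≤ Real.exp (-(2 / π ^ 2 * (l * t ^ 2))) := by
  rw [Complex.norm_exp]
  refine Real.exp_le_exp.2 ?_
  rw [Complex.neg_re, Complex.ofReal_re]
  have h : 2 / π ^ 2 ≤ 1 / 2 := by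
    rw [div_le_div_iff₀ (by positivity) (by norm_num)]
    nlinarith [Real.pi_gt_three]
  have h2 : 0 ≤ l * t ^ 2 := by positivity
  nlinarith

lemma two_div_pi_sq_mul_le {t : ℝ} (ht : |t| ≤ π) : 2 / π ^ 2 * t ^ 2 ≤ 1 - Real.cos t := by
  linarith [Real.cos_le_one_sub_mul_cos_sq ht]

lemma norm_cexp_taylor_le {t : ℝ} (ht : |t| ≤ π) (n : ℕ) :
    ‖Complex.exp (t * Complex.I) - ∑ m ∈ Finset.range n, (t * Complex.I) ^ m / (m.factorial : ℂ)‖ ≤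
      |t| ^ n * Real.exp π := by
  have h := Complex.norm_exp_sub_sum_le_norm_mul_exp (t * Complex.I) n
  have e : ‖(t : ℂ) * Complex.I‖ = |t| := by simp
  rw [e] at h
  exact h.trans (mul_le_mul_of_nonneg_left (Real.exp_le_exp.2 ht) (by positivity))

/-- The characteristic function of a centred Poisson variable, to first order. -/
lemma norm_cexp_poisson_sub_le {l : ℝ} (hl : 0 ≤ l) {t : ℝ} (ht : |t| ≤ π) :
    ‖Complex.exp (l * (Complex.exp (t * Complex.I) - 1 - t * Complex.I)) -
        Complex.exp (-(l * t ^ 2 / 2 : ℝ)) * (1 + l * (t * Complex.I) ^ 3 / 6)‖ ≤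
      (3 * Real.exp π ^ 2 + Real.exp π) * (l * t ^ 4 + l ^ 2 * t ^ 6) *
        Real.exp (-(2 / π ^ 2 * (l * t ^ 2))) := by
  set A : ℂ := l * (Complex.exp (t * Complex.I) - 1 - t * Complex.I) with hA
  set B : ℂ := -(l * t ^ 2 / 2 : ℝ) with hB
  set E := Real.exp (-(2 / π ^ 2 * (l * t ^ 2))) with hE
  set M := Real.exp π with hM
  have hMpos : 0 < M := Real.exp_pos _
  have hEpos : 0 < E := Real.exp_pos _
  have hBE : ‖Complex.exp B‖ ≤ E := norm_cexp_neg_half_le hl t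
  have hAE : ‖Complex.exp A‖ ≤ E := by
    rw [Complex.norm_exp]
    refine Real.exp_le_exp.2 ?_
    have : A.re = -(l * (1 - Real.cos t)) := by
      rw [hA, Complex.re_ofReal_mul, Complex.sub_re, cexp_mul_I_sub_one_re]
      simp
      ring
    rw [this]
    have := mul_le_mul_of_nonneg_left (two_div_pi_sq_mul_le ht) hl
    linarith
  have hB' : B = l * (t * Complex.I) ^ 2 / 2 := by
    rw [hB, mul_pow, Complex.I_sq]; push_cast; ring
  have h3 : ‖A - B‖ ≤ l * (|t| ^ 3 * M) := by
    have e : A - B = l * (Complex.exp (t * Complex.I) -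
        ∑ m ∈ Finset.range 3, (t * Complex.I) ^ m / (m.factorial : ℂ)) := by
      rw [hB', hA]; simp [Finset.sum_range_succ, Nat.factorial]; ring
    rw [e, norm_mul, Complex.norm_real, Real.norm_eq_abs, abs_of_nonneg hl]
    exact mul_le_mul_of_nonneg_left (norm_cexp_taylor_le ht 3) hl
  have h4 : ‖A - B - l * (t * Complex.I) ^ 3 / 6‖ ≤ l * (|t| ^ 4 * M) := by
    have e : A - B - l * (t * Complex.I) ^ 3 / 6 = l * (Complex.exp (t * Complex.I) -
        ∑ m ∈ Finset.range 4, (t * Complex.I) ^ m / (m.factorial : ℂ)) := by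
      rw [hB', hA]; simp [Finset.sum_range_succ, Nat.factorial]; ring
    rw [e, norm_mul, Complex.norm_real, Real.norm_eq_abs, abs_of_nonneg hl]
    exact mul_le_mul_of_nonneg_left (norm_cexp_taylor_le ht 4) hl
  have h5 : ‖Complex.exp B * (Complex.exp (A - B) - 1 - (A - B))‖ ≤ 3 * (l * (|t| ^ 3 * M)) ^ 2 * E := by
    rw [norm_mul]
    have h := norm_cexp_sub_one_sub_id_le (A - B)
    have h' : ‖Complex.exp B‖ * (Real.exp (A - B).re + 2) ≤ 3 * E := by
      rw [mul_add, ← Complex.norm_exp (A - B), ← norm_mul, ← Complex.exp_add, add_sub_cancel]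
      linarith
    calc _ ≤ ‖Complex.exp B‖ * (‖A - B‖ ^ 2 * (Real.exp (A - B).re + 2)) :=
          mul_le_mul_of_nonneg_left h (norm_nonneg _)
      _ = ‖A - B‖ ^ 2 * (‖Complex.exp B‖ * (Real.exp (A - B).re + 2)) := by ring
      _ ≤ (l * (|t| ^ 3 * M)) ^ 2 * (3 * E) := by gcongr
      _ = _ := by ring
  have h6 : ‖Complex.exp B * (A - B - l * (t * Complex.I) ^ 3 / 6)‖ ≤ E * (l * (|t| ^ 4 * M)) := by
    rw [norm_mul]
    exact mul_le_mul hBE h4 (norm_nonneg _) hEpos.le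
  have e : Complex.exp A - Complex.exp B * (1 + l * (t * Complex.I) ^ 3 / 6) =
      Complex.exp B * (Complex.exp (A - B) - 1 - (A - B)) +
        Complex.exp B * (A - B - l * (t * Complex.I) ^ 3 / 6) := by
    have : Complex.exp A = Complex.exp B * Complex.exp (A - B) := by
      rw [← Complex.exp_add, add_sub_cancel]
    rw [this]; ring
  rw [e]
  refine (norm_add_le _ _).trans ((add_le_add h5 h6).trans ?_)
  have e3 : (l * (|t| ^ 3 * M)) ^ 2 = l ^ 2 * t ^ 6 * M ^ 2 := by
    rw [mul_pow, mul_pow, ← pow_mul, (by norm_num : 3 * 2 = 6), Even.pow_abs (by decide)]; ring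
  have e4 : |t| ^ 4 = t ^ 4 := Even.pow_abs (by decide) t
  rw [e3, e4]
  have p1 : 0 ≤ l ^ 2 * t ^ 6 * M * E := by positivity
  have p2 : 0 ≤ 3 * (l * t ^ 4) * M ^ 2 * E := by positivity
  linarith

lemma norm_cexp_sub_edgeworthChar_le {l : ℝ} (hl : 0 ≤ l) {t : ℝ} (ht : |t| ≤ π) {D δ a ε : ℝ}
    (hδ : |δ| ≤ D) (ha : |a| ≤ D) (hε : |δ - a| ≤ ε) :
    ‖Complex.exp (((l + δ : ℝ) : ℂ) * (Complex.exp (t * Complex.I) - 1) - l * (t * Complex.I)) -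
        edgeworthChar l a t‖ ≤
      ((D ^ 2 * (Real.exp (2 * D) + 2) + D * Real.exp π +
          (1 + D * π) * (3 * Real.exp π ^ 2 + Real.exp π) + D) *
            (t ^ 2 + l * t ^ 4 + l ^ 2 * t ^ 6) + ε * |t|) *
        Real.exp (-(2 / π ^ 2 * (l * t ^ 2))) := by
  have hD : 0 ≤ D := (abs_nonneg _).trans hδ
  have hP := norm_cexp_poisson_sub_le hl ht
  have hBE := norm_cexp_neg_half_le hl t
  unfold edgeworthChar
  have hure := cexp_mul_I_sub_one_re t
  have hun := norm_cexp_mul_I_sub_one_le t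
  have hw2 : ‖Complex.exp (t * Complex.I) - 1 - t * Complex.I‖ ≤ t ^ 2 * Real.exp π := by
    have := norm_cexp_taylor_le ht 2
    simpa [Finset.sum_range_succ, ← sub_sub] using this
  have hAE : ‖Complex.exp (l * (Complex.exp (t * Complex.I) - 1 - t * Complex.I))‖ ≤
      Real.exp (-(2 / π ^ 2 * (l * t ^ 2))) := by
    rw [Complex.norm_exp]
    refine Real.exp_le_exp.2 ?_
    rw [Complex.re_ofReal_mul, Complex.sub_re, hure]
    have := mul_le_mul_of_nonneg_left (two_div_pi_sq_mul_le ht) hl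
    simp
    linarith
  have hc0 : 0 ≤ 1 - Real.cos t := by linarith [Real.cos_le_one t]
  have hc2 : 1 - Real.cos t ≤ 2 := by linarith [Real.neg_one_le_cos t]
  set w := Complex.exp (t * Complex.I) - 1 with hw
  set E := Real.exp (-(2 / π ^ 2 * (l * t ^ 2))) with hE
  set M := Real.exp π with hM
  set B := Complex.exp (-(l * t ^ 2 / 2 : ℝ)) with hB
  set A := Complex.exp (l * (w - t * Complex.I)) with hA
  have hEpos : 0 < E := Real.exp_pos _
  have hMpos : 0 < M := Real.exp_pos _
  have e1 : Complex.exp (((l + δ : ℝ) : ℂ) * w - l * (t * Complex.I)) =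
      A * Complex.exp (δ * w) := by
    rw [hA, ← Complex.exp_add]; congr 1; push_cast; ring
  have e2 : A * Complex.exp (δ * w) - B * (1 + a * (t * Complex.I) + l * (t * Complex.I) ^ 3 / 6) =
      A * ((Complex.exp (δ * w) - 1 - δ * w) + δ * (w - t * Complex.I) +
        ((δ - a : ℝ) : ℂ) * (t * Complex.I)) +
      (1 + a * (t * Complex.I)) * (A - B * (1 + l * (t * Complex.I) ^ 3 / 6)) +
      B * (a * (t * Complex.I) * (l * (t * Complex.I) ^ 3 / 6)) := by
    push_cast; ring
  have nI : ‖(t : ℂ) * Complex.I‖ = |t| := by simp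
  have b1 : ‖Complex.exp (δ * w) - 1 - δ * w‖ ≤ D ^ 2 * t ^ 2 * (Real.exp (2 * D) + 2) := by
    refine (norm_cexp_sub_one_sub_id_le _).trans ?_
    have r : ((δ : ℂ) * w).re ≤ 2 * D := by
      rw [Complex.re_ofReal_mul, hure]
      have := neg_abs_le δ
      nlinarith
    have n : ‖(δ : ℂ) * w‖ ^ 2 ≤ D ^ 2 * t ^ 2 := by
      rw [norm_mul, Complex.norm_real, Real.norm_eq_abs, mul_pow, ← sq_abs t]
      gcongr
    gcongr
  have b2 : ‖(δ : ℂ) * (w - t * Complex.I)‖ ≤ D * (t ^ 2 * M) := by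
    rw [norm_mul, Complex.norm_real, Real.norm_eq_abs]
    gcongr
  have b3 : ‖((δ - a : ℝ) : ℂ) * (t * Complex.I)‖ ≤ ε * |t| := by
    rw [norm_mul, nI, Complex.norm_real, Real.norm_eq_abs]
    gcongr
  have b4 : ‖1 + (a : ℂ) * (t * Complex.I)‖ ≤ 1 + D * π := by
    refine (norm_add_le _ _).trans ?_
    rw [norm_one, norm_mul, nI, Complex.norm_real, Real.norm_eq_abs]
    gcongr
  have b5 : ‖(a : ℂ) * (t * Complex.I) * (l * (t * Complex.I) ^ 3 / 6)‖ ≤ D * (l * t ^ 4) := by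
    rw [norm_mul, norm_mul (a : ℂ), norm_div, norm_mul (l : ℂ), norm_pow, nI, Complex.norm_real, Complex.norm_real,
      Real.norm_eq_abs, Real.norm_eq_abs, abs_of_nonneg hl]
    have e4 : |t| ^ 4 = t ^ 4 := Even.pow_abs (by decide) t
    have e6 : ‖(6 : ℂ)‖ = 6 := by simp
    have : |a| * |t| * (l * |t| ^ 3 / 6) = |a| * (l * t ^ 4) / 6 := by rw [← e4]; ring
    rw [e6, this]
    have h0 : 0 ≤ l * t ^ 4 := by positivity
    have := mul_le_mul_of_nonneg_right ha h0
    have := mul_nonneg (abs_nonneg a) h0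
    linarith
  rw [e1, e2]
  have c1 := mul_le_mul hAE (norm_add₃_le.trans (add_le_add (add_le_add b1 b2) b3))
    (norm_nonneg _) hEpos.le
  have c2 := mul_le_mul b4 hP (norm_nonneg _) (by positivity)
  have c3 := mul_le_mul hBE b5 (norm_nonneg _) hEpos.le
  rw [← norm_mul] at c1 c2 c3
  refine norm_add₃_le.trans ((add_le_add (add_le_add c1 c2) c3).trans ?_)
  have p1 : 0 ≤ D ^ 2 * (Real.exp (2 * D) + 2) * (l * t ^ 4 + l ^ 2 * t ^ 6) * E := by positivity
  have p2 : 0 ≤ D * M * (l * t ^ 4 + l ^ 2 * t ^ 6) * E := by positivity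
  have p3 : 0 ≤ (1 + D * π) * (3 * M ^ 2 + M) * t ^ 2 * E := by positivity
  have p4 : 0 ≤ D * (t ^ 2 + l ^ 2 * t ^ 6) * E := by positivity
  linarith

lemma norm_edgeworthChar_le {l : ℝ} (hl : 0 ≤ l) {t : ℝ} (ht : 1 ≤ |t|) {D a : ℝ}
    (ha : |a| ≤ D) :
    ‖edgeworthChar l a t‖ ≤
      (1 + D) * (t ^ 2 + l * t ^ 4 + l ^ 2 * t ^ 6) *
        Real.exp (-(2 / π ^ 2 * (l * t ^ 2))) := by
  have hD : 0 ≤ D := (abs_nonneg _).trans ha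
  have nI : ‖(t : ℂ) * Complex.I‖ = |t| := by simp
  have e6 : ‖(6 : ℂ)‖ = 6 := by simp
  unfold edgeworthChar
  rw [norm_mul, mul_comm]
  refine mul_le_mul ?_ (norm_cexp_neg_half_le hl t) (norm_nonneg _) (by positivity)
  refine norm_add₃_le.trans ?_
  rw [norm_one, norm_mul (a : ℂ), norm_div, norm_mul (l : ℂ), norm_pow, nI, Complex.norm_real, Complex.norm_real,
      Real.norm_eq_abs, Real.norm_eq_abs, abs_of_nonneg hl, e6]
  have h1 : |t| ≤ t ^ 2 := by rw [← sq_abs]; nlinarith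
  have h2 : 1 ≤ t ^ 2 := ht.trans h1
  have h3 : l * |t| ^ 3 ≤ l * t ^ 4 := by
    rw [← Even.pow_abs (by decide : Even 4) t]
    exact mul_le_mul_of_nonneg_left (pow_le_pow_right₀ ht (by norm_num)) hl
  have h4 : |a| * |t| ≤ D * t ^ 2 := mul_le_mul ha h1 (abs_nonneg _) hD
  have h5 : 0 ≤ D * (l * t ^ 4 + l ^ 2 * t ^ 6) := by positivity
  have h6 : 0 ≤ l * t ^ 4 := by positivity
  have h7 : 0 ≤ l ^ 2 * t ^ 6 := by positivity
  have h8 : 0 ≤ l * |t| ^ 3 := by positivity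
  linarith

lemma exists_polynomial_mul_exp_le {c : ℝ} (hc : 0 < c) :
    ∃ K : ℝ, 0 < K ∧ ∀ y : ℝ, 0 ≤ y →
      (y + y ^ 2 + y ^ 3) * Real.exp (-(c * y)) ≤ K * Real.exp (-(c / 2 * y)) := by
  refine ⟨1 / (c / 2) + 2 / (c / 2) ^ 2 + 6 / (c / 2) ^ 3, by positivity, fun y hy => ?_⟩
  have hx : 0 ≤ c / 2 * y := by positivity
  have h1 := Real.pow_div_factorial_le_exp _ hx 1
  have h2 := Real.pow_div_factorial_le_exp _ hx 2
  have h3 := Real.pow_div_factorial_le_exp _ hx 3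
  simp only [Nat.factorial, Nat.succ_eq_add_one, mul_pow] at h1 h2 h3
  norm_num at h1 h2 h3
  have e : Real.exp (-(c / 2 * y)) = Real.exp (c / 2 * y) * Real.exp (-(c * y)) := by
    rw [← Real.exp_add]; congr 1; ring
  rw [e, ← mul_assoc]
  refine mul_le_mul_of_nonneg_right ?_ (Real.exp_pos _).le
  set X := Real.exp (c / 2 * y)
  have g1 : y ≤ 1 / (c / 2) * X := by
    rw [div_mul_eq_mul_div, le_div_iff₀ (by positivity)]; linarith
  have g2 : y ^ 2 ≤ 2 / (c / 2) ^ 2 * X := by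
    rw [div_mul_eq_mul_div, le_div_iff₀ (by positivity)]; linarith
  have g3 : y ^ 3 ≤ 6 / (c / 2) ^ 3 * X := by
    rw [div_mul_eq_mul_div, le_div_iff₀ (by positivity)]; linarith
  linarith

lemma exists_norm_charFun_sub_edgeworthChar_le {α β : ℝ} (hα : 0 < α) (hαβ : α ≤ β) :
    ∃ C c : ℝ, 0 ≤ C ∧ 0 < c ∧ ∀ n : ℕ, 1 ≤ Real.log n → ∀ θ : ℝ, α ≤ θ → θ ≤ β → ∀ t : ℝ,
      ‖(Set.Ioc (-π) π).indicator (fun t : ℝ =>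
          (∏ j ∈ Finset.range n, (1 + ((θ / (θ + j) : ℝ) : ℂ) * (Complex.exp (t * Complex.I) - 1))) *
            Complex.exp (-((θ * Real.log n : ℝ) * (t * Complex.I)))) t -
          edgeworthChar (θ * Real.log n) (-(θ * digamma θ)) t‖ ≤
        C / Real.log n * Real.exp (-(c * Real.log n) * t ^ 2) := by
  obtain ⟨K, hK, hKy⟩ := exists_polynomial_mul_exp_le (c := 2 / π ^ 2) (by positivity)
  have hβ : 0 < β := hα.trans_le hαβ
  obtain ⟨N, hN⟩ : ∃ x, x = β * (β + 1) := ⟨_, rfl⟩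
  obtain ⟨D, hD⟩ : ∃ x, x = β ^ 2 + 2 + N := ⟨_, rfl⟩
  obtain ⟨K₁, hK₁⟩ : ∃ x, x = 3 * Real.exp 1 * (1 + β) * Real.exp (2 * (1 + β)) * Real.exp (2 * D) := ⟨_, rfl⟩
  obtain ⟨K₂, hK₂⟩ : ∃ x, x = D ^ 2 * (Real.exp (2 * D) + 2) + D * Real.exp π +
          (1 + D * π) * (3 * Real.exp π ^ 2 + Real.exp π) + D := ⟨_, rfl⟩
  have hNpos : 0 < N := by rw [hN]; positivity
  have hDpos : 0 < D := by rw [hD]; positivity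
  have hK₁pos : 0 < K₁ := by rw [hK₁]; positivity
  have hK₂pos : 0 < K₂ := by rw [hK₂]; positivity
  refine ⟨(K₁ + K₂ + 1 + (1 + D)) * (K / α) + N ^ 2, 2 / π ^ 2 / 2 * α, by positivity,
    by positivity, fun n hT θ hθα hθβ t => ?_⟩
  have hθ : 0 < θ := hα.trans_le hθα
  set T := Real.log n with hTdef
  have hTpos : 0 < T := by linarith
  have hn : 0 < n := by
    rcases Nat.eq_zero_or_pos n with h | h
    · subst h; simp at hTdef; linarith
    · exact h
  have hn' : (0 : ℝ) < n := Nat.cast_pos.2 hn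
  have hTn : T ≤ n := (Real.log_le_sub_one_of_pos hn').trans (by linarith)
  set l := θ * T with hl
  have hlpos : 0 < l := by positivity
  set a := -(θ * digamma θ) with ha
  set E := Real.exp (-(2 / π ^ 2 * (l * t ^ 2))) with hE
  set G := Real.exp (-(2 / π ^ 2 / 2 * α * T) * t ^ 2) with hG
  have hEpos : 0 < E := Real.exp_pos _
  have hGpos : 0 < G := Real.exp_pos _
  set Q := t ^ 2 + l * t ^ 4 + l ^ 2 * t ^ 6 with hQ
  have hQ0 : 0 ≤ Q := by positivity
  have hlαT : α * T ≤ l := mul_le_mul_of_nonneg_right hθα hTpos.le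
  have hαTt : 2 / π ^ 2 / 2 * (α * T) * t ^ 2 ≤ 2 / π ^ 2 / 2 * (l * t ^ 2) := by
    rw [mul_assoc]
    gcongr
  have hQE : Q * E ≤ K / α / T * G := by
    have h := hKy (l * t ^ 2) (by positivity)
    have e : Q * E = (l * t ^ 2 + (l * t ^ 2) ^ 2 + (l * t ^ 2) ^ 3) * E / l := by
      rw [hQ]; field_simp
    have h2 : Real.exp (-(2 / π ^ 2 / 2 * (l * t ^ 2))) ≤ G :=
      Real.exp_le_exp.2 (by linarith)
    rw [e, div_div]
    calc _ ≤ K * G / l :=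
          div_le_div_of_nonneg_right (h.trans (mul_le_mul_of_nonneg_left h2 hK.le)) hlpos.le
      _ ≤ K * G / (α * T) := by gcongr
      _ = _ := by ring
  have hEG : E ≤ G := Real.exp_le_exp.2 (by
    have : 0 ≤ 2 / π ^ 2 / 2 * (l * t ^ 2) := by positivity
    linarith)
  have hbound : (K₁ + K₂ + 1 + (1 + D)) * (Q * E) + N ^ 2 / T * E ≤
      ((K₁ + K₂ + 1 + (1 + D)) * (K / α) + N ^ 2) / T * G := by
    have h1 := mul_le_mul_of_nonneg_left hQE
      (by positivity : 0 ≤ K₁ + K₂ + 1 + (1 + D))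
    have h2 := mul_le_mul_of_nonneg_left hEG (by positivity : 0 ≤ N ^ 2 / T)
    refine (add_le_add h1 h2).trans (le_of_eq ?_)
    ring
  have haN : |a| ≤ β ^ 2 + 2 := by
    rw [ha, abs_neg]
    refine (abs_mul_digamma_le hθ).trans ?_
    gcongr
  have haD : |a| ≤ D := by linarith only [haN, hD, hNpos]
  refine le_trans ?_ hbound
  by_cases ht : t ∈ Set.Ioc (-π) π
  · rw [Set.indicator_of_mem ht]
    have htπ : |t| ≤ π := abs_le.2 ⟨ht.1.le, ht.2⟩
    set μ := ∑ j ∈ Finset.range n, θ / (θ + j) with hμ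
    have hε : |(μ - l) - a| ≤ N / T := by
      have h := abs_sum_div_add_sub_le hθ hn
      have e : (μ - l) - a = μ - (l - θ * digamma θ) := by rw [ha]; ring
      rw [e]
      refine h.trans ?_
      rw [hN]
      gcongr
    have hNT : N / T ≤ N := div_le_self hNpos.le hT
    have hδ : |μ - l| ≤ D := by
      have : |μ - l| ≤ |(μ - l) - a| + |a| := by
        have := abs_add_le ((μ - l) - a) a
        rwa [sub_add_cancel] at this
      linarith only [this, hε, hNT, haN, hD]
    have hS : ∑ j ∈ Finset.range n, (θ / (θ + j)) ^ 2 ≤ 1 + β :=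
      (sum_div_add_sq_le hθ n).trans (by linarith)
    have b1 := norm_prod_sub_cexp_sum_le (Finset.range n) (fun j => θ / (θ + j))
      (fun j _ => by positivity) (fun j _ => by
        have : (0 : ℝ) ≤ j := j.cast_nonneg
        exact div_le_one_of_le₀ (by linarith) (by linarith)) t
    have b2 := norm_cexp_sub_edgeworthChar_le hlpos.le htπ hδ haD hε
    rw [add_sub_cancel, ← hK₂] at b2
    have hc0 : 0 ≤ 1 - Real.cos t := by linarith [Real.cos_le_one t]
    have hc2 : 1 - Real.cos t ≤ 2 := by linarith [Real.neg_one_le_cos t]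
    have hexp : Real.exp (-(μ * (1 - Real.cos t))) ≤ Real.exp (2 * D) * E := by
      rw [hE, ← Real.exp_add]
      refine Real.exp_le_exp.2 ?_
      have h1 := mul_le_mul_of_nonneg_left (two_div_pi_sq_mul_le htπ) hlpos.le
      have h2 : (l - μ) * (1 - Real.cos t) ≤ 2 * D := by
        rw [mul_comm 2 D]
        exact mul_le_mul (by linarith only [(abs_le.1 hδ).1]) hc2 hc0 hDpos.le
      linarith only [h1, h2]
    have b3 : ‖∏ j ∈ Finset.range n,
          (1 + ((θ / (θ + j) : ℝ) : ℂ) * (Complex.exp (t * Complex.I) - 1)) -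
        Complex.exp ((μ : ℂ) * (Complex.exp (t * Complex.I) - 1))‖ ≤ K₁ * Q * E := by
      refine b1.trans ?_
      have hQt : t ^ 2 ≤ Q := by
        have : 0 ≤ l * t ^ 4 + l ^ 2 * t ^ 6 := by positivity
        linarith only [this, hQ]
      calc _ ≤ 3 * Real.exp 1 * (1 + β) * Real.exp (2 * (1 + β)) * Q *
            (Real.exp (2 * D) * E) := by gcongr
        _ = _ := by rw [hK₁]; ring
    set P := ∏ j ∈ Finset.range n,
          (1 + ((θ / (θ + j) : ℝ) : ℂ) * (Complex.exp (t * Complex.I) - 1)) with hP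
    have e : P * Complex.exp (-(l * (t * Complex.I))) - edgeworthChar l a t =
        (P - Complex.exp ((μ : ℂ) * (Complex.exp (t * Complex.I) - 1))) *
          Complex.exp (-(l * (t * Complex.I))) +
        (Complex.exp ((μ : ℂ) * (Complex.exp (t * Complex.I) - 1) - l * (t * Complex.I)) -
          edgeworthChar l a t) := by
      rw [sub_eq_add_neg ((μ : ℂ) * _) (l * (t * Complex.I)), Complex.exp_add]; ring
    have e1 : ‖Complex.exp (-(l * (t * Complex.I)))‖ = 1 := by
      rw [Complex.norm_exp]; simp
    rw [e]
    refine (norm_add_le _ _).trans ?_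
    rw [norm_mul, e1, mul_one]
    refine (add_le_add b3 b2).trans ?_
    have hεt : N / T * |t| ≤ Q + N ^ 2 / T := by
      have h1 : N / T * |t| ≤ t ^ 2 + (N / T) ^ 2 := by
        rw [← sq_abs t]
        nlinarith only [sq_nonneg (N / T - |t|), sq_nonneg (N / T), sq_nonneg |t|]
      have h2 : (N / T) ^ 2 ≤ N ^ 2 / T := by
        rw [div_pow]
        gcongr
        nlinarith only [hT]
      have : 0 ≤ l * t ^ 4 + l ^ 2 * t ^ 6 := by positivity
      linarith only [h1, h2, this, hQ]
    have h3 := mul_le_mul_of_nonneg_right hεt hEpos.le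
    have h4 : 0 ≤ (1 + D) * Q * E := by positivity
    linarith only [h3, h4]
  · rw [Set.indicator_of_notMem ht, zero_sub, norm_neg]
    have ht1 : 1 ≤ |t| := by
      by_contra! h
      have := abs_lt.1 h
      exact ht ⟨by linarith [Real.pi_gt_three], by linarith [Real.pi_gt_three]⟩
    refine (norm_edgeworthChar_le hlpos.le ht1 haD).trans ?_
    have h1 : 0 ≤ (K₁ + K₂ + 1) * (Q * E) := by positivity
    have h2 : 0 ≤ N ^ 2 / T * E := by positivity
    linarith only [h1, h2]

lemma integrable_pow_mul_cexp_gaussian {l : ℝ} (hl : 0 < l) (y : ℝ) (k : ℕ) :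
    MeasureTheory.Integrable fun t : ℝ =>
      (t : ℂ) ^ k * Complex.exp (-(l / 2) * t ^ 2 - y * t * Complex.I) := by
  have h := (integrable_rpow_mul_exp_neg_mul_sq (b := l / 2) (by positivity) (s := k)
    (by have : (0 : ℝ) ≤ k := k.cast_nonneg
        linarith)).norm
  refine h.mono' (by fun_prop) (Eventually.of_forall fun t => le_of_eq ?_)
  have e : (-((l : ℂ) / 2) * (t : ℂ) ^ 2 - y * t * Complex.I).re = -(l / 2) * t ^ 2 := by
    simp [← Complex.ofReal_pow]
  rw [norm_mul, norm_pow, Complex.norm_exp, e, Complex.norm_real, Real.rpow_natCast, norm_mul,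
    norm_pow, Real.norm_of_nonneg (Real.exp_pos _).le]

/-- Integration by parts for the moments of a Gaussian against a character. -/
lemma integral_pow_succ_mul_cexp_gaussian {l : ℝ} (hl : 0 < l) (y : ℝ) (k : ℕ) :
    l * ∫ t : ℝ, (t : ℂ) ^ (k + 1) * Complex.exp (-(l / 2) * t ^ 2 - y * t * Complex.I) =
      k * (∫ t : ℝ, (t : ℂ) ^ (k - 1) * Complex.exp (-(l / 2) * t ^ 2 - y * t * Complex.I)) -
      y * Complex.I *
        ∫ t : ℝ, (t : ℂ) ^ k * Complex.exp (-(l / 2) * t ^ 2 - y * t * Complex.I) := by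
  have i1 := (integrable_pow_mul_cexp_gaussian hl y (k + 1)).const_mul (l : ℂ)
  have i2 := (integrable_pow_mul_cexp_gaussian hl y (k - 1)).const_mul (k : ℂ)
  have i3 := (integrable_pow_mul_cexp_gaussian hl y k).const_mul (y * Complex.I)
  have hd : ∀ t : ℝ, HasDerivAt
      (fun t : ℝ => (t : ℂ) ^ k * Complex.exp (-(l / 2) * t ^ 2 - y * t * Complex.I))
      (k * ((t : ℂ) ^ (k - 1) * Complex.exp (-(l / 2) * t ^ 2 - y * t * Complex.I)) -
        y * Complex.I * ((t : ℂ) ^ k * Complex.exp (-(l / 2) * t ^ 2 - y * t * Complex.I)) -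
        l * ((t : ℂ) ^ (k + 1) * Complex.exp (-(l / 2) * t ^ 2 - y * t * Complex.I))) t := by
    intro t
    have h1 : HasDerivAt (fun z : ℂ => z ^ k * Complex.exp (-(l / 2) * z ^ 2 - y * z * Complex.I))
        (k * (t : ℂ) ^ (k - 1) * Complex.exp (-(l / 2) * t ^ 2 - y * t * Complex.I) +
          (t : ℂ) ^ k * (Complex.exp (-(l / 2) * t ^ 2 - y * t * Complex.I) *
            (-(l / 2) * (2 * t) - y * Complex.I))) (t : ℂ) := by
      refine (hasDerivAt_pow k _).mul (HasDerivAt.cexp ?_)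
      refine HasDerivAt.sub ?_ ?_
      · simpa using (hasDerivAt_pow 2 (t : ℂ)).const_mul (-((l : ℂ) / 2))
      · simpa using ((hasDerivAt_id (t : ℂ)).const_mul (y : ℂ)).mul_const Complex.I
    convert h1.comp_ofReal using 1
    ring
  have h := MeasureTheory.integral_eq_zero_of_hasDerivAt_of_integrable hd ((i2.sub i3).sub i1)
    (integrable_pow_mul_cexp_gaussian hl y k)
  have i23 : MeasureTheory.Integrable fun t : ℝ =>
      k * ((t : ℂ) ^ (k - 1) * Complex.exp (-(l / 2) * t ^ 2 - y * t * Complex.I)) -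
        y * Complex.I * ((t : ℂ) ^ k * Complex.exp (-(l / 2) * t ^ 2 - y * t * Complex.I)) :=
    i2.sub i3
  rw [MeasureTheory.integral_sub i23 i1, MeasureTheory.integral_sub i2 i3] at h
  simp only [MeasureTheory.integral_const_mul] at h
  linear_combination -h

lemma integral_cexp_gaussian {l : ℝ} (hl : 0 < l) (y : ℝ) :
    ∫ t : ℝ, Complex.exp (-(l / 2) * t ^ 2 - y * t * Complex.I) =
      (Real.sqrt (2 * π / l) * Real.exp (-(y ^ 2 / (2 * l))) : ℝ) := by
  have h := fourierIntegral_gaussian (b := (l : ℂ) / 2)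
    (by simpa using hl) (-y : ℂ)
  have e : ∀ t : ℝ, Complex.exp (-((l : ℂ) / 2) * t ^ 2 - y * t * Complex.I) =
      Complex.exp (Complex.I * -y * t) * Complex.exp (-((l : ℂ) / 2) * t ^ 2) := fun t => by
    rw [← Complex.exp_add]; congr 1; ring
  simp_rw [e]
  rw [h, Real.sqrt_eq_rpow, Complex.ofReal_mul, Complex.ofReal_cpow (by positivity)]
  push_cast
  congr 2
  · field_simp
  · field_simp
    norm_num

lemma edgeworthChar_mul_cexp (l a y t : ℝ) :
    edgeworthChar l a t * Complex.exp (-(y * t * Complex.I)) =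
      (t : ℂ) ^ 0 * Complex.exp (-(l / 2) * t ^ 2 - y * t * Complex.I) +
      a * Complex.I * ((t : ℂ) ^ 1 * Complex.exp (-(l / 2) * t ^ 2 - y * t * Complex.I)) -
      l * Complex.I / 6 *
        ((t : ℂ) ^ 3 * Complex.exp (-(l / 2) * t ^ 2 - y * t * Complex.I)) := by
  have e : Complex.exp (-((l : ℂ) / 2) * t ^ 2 - y * t * Complex.I) =
      Complex.exp (-(l * t ^ 2 / 2 : ℝ)) * Complex.exp (-(y * t * Complex.I)) := by
    rw [← Complex.exp_add]; congr 1; push_cast; ring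
  unfold edgeworthChar
  rw [e, mul_pow (t : ℂ) Complex.I 3, Complex.I_pow_three]
  ring

lemma integrable_edgeworthChar_mul_cexp {l : ℝ} (hl : 0 < l) (a y : ℝ) :
    MeasureTheory.Integrable fun t : ℝ =>
      edgeworthChar l a t * Complex.exp (-(y * t * Complex.I)) := by
  simp_rw [edgeworthChar_mul_cexp]
  exact ((integrable_pow_mul_cexp_gaussian hl y 0).add
    ((integrable_pow_mul_cexp_gaussian hl y 1).const_mul _)).sub
      ((integrable_pow_mul_cexp_gaussian hl y 3).const_mul _)

lemma integral_edgeworthChar_mul_cexp {l : ℝ} (hl : 0 < l) (a y : ℝ) :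
    ∫ t : ℝ, edgeworthChar l a t * Complex.exp (-(y * t * Complex.I)) =
      (Real.sqrt (2 * π / l) * Real.exp (-(y ^ 2 / (2 * l))) *
        (1 + a * (y / l) + (y ^ 3 / l ^ 2 - 3 * y / l) / 6) : ℝ) := by
  have i0 := integrable_pow_mul_cexp_gaussian hl y 0
  have i1 := (integrable_pow_mul_cexp_gaussian hl y 1).const_mul (a * Complex.I)
  have i3 := (integrable_pow_mul_cexp_gaussian hl y 3).const_mul (l * Complex.I / 6)
  have r1 := integral_pow_succ_mul_cexp_gaussian hl y 0
  have r2 := integral_pow_succ_mul_cexp_gaussian hl y 1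
  have r3 := integral_pow_succ_mul_cexp_gaussian hl y 2
  have r0 := integral_cexp_gaussian hl y
  have hl' : (l : ℂ) ≠ 0 := Complex.ofReal_ne_zero.2 hl.ne'
  simp_rw [edgeworthChar_mul_cexp]
  rw [MeasureTheory.integral_sub (i0.fun_add i1) i3, MeasureTheory.integral_add i0 i1]
  simp only [MeasureTheory.integral_const_mul]
  rw [Complex.ofReal_mul, ← r0]
  norm_num only [pow_zero, one_mul, Nat.cast_zero, zero_mul, zero_sub, zero_add, Nat.cast_one,
    Nat.cast_ofNat, Nat.reduceAdd, Nat.reduceSub, pow_one] at r1 r2 r3 ⊢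
  set M0 := ∫ t : ℝ, Complex.exp (-((l : ℂ) / 2) * t ^ 2 - y * t * Complex.I)
  set M1 := ∫ t : ℝ, (t : ℂ) * Complex.exp (-((l : ℂ) / 2) * t ^ 2 - y * t * Complex.I)
  set M2 := ∫ t : ℝ, (t : ℂ) ^ 2 * Complex.exp (-((l : ℂ) / 2) * t ^ 2 - y * t * Complex.I)
  set M3 := ∫ t : ℝ, (t : ℂ) ^ 3 * Complex.exp (-((l : ℂ) / 2) * t ^ 2 - y * t * Complex.I)
  have I2 := Complex.I_sq
  have I4 := Complex.I_pow_four
  have s1 : M1 = -(y * Complex.I * M0) / l := by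
    rw [eq_div_iff hl']; linear_combination r1
  have s2 : M2 = (M0 - y * Complex.I * M1) / l := by
    rw [eq_div_iff hl']; linear_combination r2
  have s3 : M3 = (2 * M1 - y * Complex.I * M2) / l := by
    rw [eq_div_iff hl']; linear_combination r3
  rw [s3, s2, s1]
  push_cast
  field_simp
  ring_nf
  rw [I2, I4]
  ring

lemma ascPochhammer_eval_eq_prod {R : Type*} [CommSemiring R] (n : ℕ) (x : R) :
    (ascPochhammer R n).eval x = ∏ j ∈ Finset.range n, (x + j) := by
  induction n with
  | zero => simp
  | succ n ih => rw [ascPochhammer_succ_eval, ih, Finset.prod_range_succ]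

/-- The probability generating function of the Ewens distribution. -/
lemma prod_eq_sum_ewensPMF {θ : ℝ} (hθ : 0 < θ) (n : ℕ) (z : ℂ) :
    ∏ j ∈ Finset.range n, (1 + ((θ / (θ + j) : ℝ) : ℂ) * (z - 1)) =
      ∑ m ∈ Finset.range (n + 1), (ewensPMF n θ m : ℂ) * z ^ m := by
  have hne : ∀ j : ℕ, (θ : ℂ) + j ≠ 0 := fun j => by
    have : θ + (j : ℝ) ≠ 0 := by positivity
    exact_mod_cast this
  have h1 : ∏ j ∈ Finset.range n, (1 + ((θ / (θ + j) : ℝ) : ℂ) * (z - 1)) =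
      (ascPochhammer ℂ n).eval (θ * z) / (ascPochhammer ℝ n).eval θ := by
    rw [ascPochhammer_eval_eq_prod, ascPochhammer_eval_eq_prod, Complex.ofReal_prod,
      ← Finset.prod_div_distrib]
    refine Finset.prod_congr rfl fun j _ => ?_
    have := hne j
    push_cast
    field_simp
    ring
  rw [h1, Polynomial.eval_eq_sum_range' (n := n + 1)
    (by rw [ascPochhammer_natDegree]; exact n.lt_succ_self), Finset.sum_div]
  refine Finset.sum_congr rfl fun m _ => ?_
  rw [← ascPochhammer_map (Nat.castRingHom ℂ), Polynomial.coeff_map, ewensPMF]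
  push_cast
  rw [mul_pow]
  ring

lemma integral_cexp_int_mul_I (m : ℤ) :
    ∫ t in (-π)..π, Complex.exp (m * Complex.I * t) = if m = 0 then (2 * π : ℂ) else 0 := by
  split_ifs with h
  · subst h
    simp
    ring
  · have hc : (m : ℂ) * Complex.I ≠ 0 := mul_ne_zero (Int.cast_ne_zero.2 h) Complex.I_ne_zero
    rw [integral_exp_mul_complex hc]
    have : Complex.exp (m * Complex.I * (π : ℝ)) = Complex.exp (m * Complex.I * (-π : ℝ)) := by
      rw [Complex.exp_eq_exp_iff_exists_int]
      exact ⟨m, by push_cast; ring⟩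
    rw [this, sub_self, zero_div]

lemma two_pi_mul_ewensPMF_eq_integral {θ : ℝ} (hθ : 0 < θ) {n k : ℕ} (hk : k ≤ n) :
    2 * π * (ewensPMF n θ k : ℂ) = ∫ t in (-π)..π,
      (∏ j ∈ Finset.range n,
        (1 + ((θ / (θ + j) : ℝ) : ℂ) * (Complex.exp (t * Complex.I) - 1))) *
          Complex.exp (-(k * (t * Complex.I))) := by
  have e : ∀ t : ℝ, (∏ j ∈ Finset.range n,
        (1 + ((θ / (θ + j) : ℝ) : ℂ) * (Complex.exp (t * Complex.I) - 1))) *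
          Complex.exp (-(k * (t * Complex.I))) =
      ∑ m ∈ Finset.range (n + 1),
        (ewensPMF n θ m : ℂ) * Complex.exp (((m - k : ℤ) : ℂ) * Complex.I * t) := fun t => by
    rw [prod_eq_sum_ewensPMF hθ, Finset.sum_mul]
    refine Finset.sum_congr rfl fun m _ => ?_
    rw [← Complex.exp_nat_mul, mul_assoc, ← Complex.exp_add]
    congr 2
    push_cast
    ring
  simp_rw [e]
  rw [intervalIntegral.integral_finsetSum fun m _ =>
    (by fun_prop : Continuous _).intervalIntegrable _ _]
  simp_rw [intervalIntegral.integral_const_mul, integral_cexp_int_mul_I, sub_eq_zero, Nat.cast_inj]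
  rw [Finset.sum_eq_single k]
  · simp
    ring
  · intro m _ hm
    simp [hm]
  · intro h
    exact absurd (Finset.mem_range.2 (Nat.lt_succ_of_le hk)) h

lemma two_pi_mul_edgeworth_eq_integral {θ : ℝ} (hθ : 0 < θ) {n : ℕ} (hT : 0 < Real.log n) (k : ℕ) :
    2 * π * ((Real.exp (-(xnorm n k θ) ^ 2 / 2) / Real.sqrt (2 * π * θ * Real.log n) *
        (1 + H₁ (xnorm n k θ) θ / Real.sqrt (θ * Real.log n)) : ℝ) : ℂ) =
      ∫ t : ℝ, edgeworthChar (θ * Real.log n) (-(θ * digamma θ)) t *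
        Complex.exp (-((k - θ * Real.log n : ℝ) * t * Complex.I)) := by
  have hl : 0 < θ * Real.log n := by positivity
  rw [integral_edgeworthChar_mul_cexp hl, mul_assoc (2 * π) θ]
  unfold H₁ xnorm
  set l := θ * Real.log n
  set y := (k : ℝ) - l
  obtain ⟨s, hs, hsl⟩ : ∃ s, 0 < s ∧ l = s ^ 2 :=
    ⟨Real.sqrt l, Real.sqrt_pos.2 hl, (Real.sq_sqrt hl.le).symm⟩
  obtain ⟨p, hp, hpπ⟩ : ∃ p, 0 < p ∧ 2 * π = p ^ 2 :=
    ⟨Real.sqrt (2 * π), Real.sqrt_pos.2 (by positivity), (Real.sq_sqrt (by positivity)).symm⟩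
  have h1 : Real.sqrt (2 * π * l) = p * s := by
    rw [hsl, hpπ, ← mul_pow, Real.sqrt_sq (by positivity)]
  have h2 : Real.sqrt (2 * π / l) = p / s := by
    rw [hsl, hpπ, ← div_pow, Real.sqrt_sq (by positivity)]
  have h3 : Real.sqrt l = s := by rw [hsl, Real.sqrt_sq hs.le]
  have h4 : -(y / s) ^ 2 / 2 = -(y ^ 2 / (2 * l)) := by
    rw [hsl, div_pow]; field_simp
  rw [h1, h2, h3, h4]
  have h5 : (2 * π : ℂ) = ((p ^ 2 : ℝ) : ℂ) := by rw [← hpπ]; push_cast; rfl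
  rw [h5, ← Complex.ofReal_mul]
  congr 1
  set X := Real.exp (-(y ^ 2 / (2 * l)))
  rw [hsl]
  field_simp
  ring

lemma exists_abs_ewensPMF_sub_le {α β : ℝ} (hα : 0 < α) (hαβ : α ≤ β) :
    ∃ C : ℝ, 0 ≤ C ∧ ∀ n : ℕ, 1 ≤ Real.log n → ∀ θ : ℝ, α ≤ θ → θ ≤ β → ∀ k ≤ n,
      |ewensPMF n θ k -
          Real.exp (-(xnorm n k θ) ^ 2 / 2) / Real.sqrt (2 * π * θ * Real.log n) *
            (1 + H₁ (xnorm n k θ) θ / Real.sqrt (θ * Real.log n))| ≤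
        C / (Real.log n * Real.sqrt (Real.log n)) := by
  obtain ⟨C, c, hC, hc, h⟩ := exists_norm_charFun_sub_edgeworthChar_le hα hαβ
  refine ⟨C * Real.sqrt (π / c), by positivity, fun n hT θ hθα hθβ k hk => ?_⟩
  have hθ : 0 < θ := hα.trans_le hθα
  have hTpos : 0 < Real.log n := by linarith
  have hl : 0 < θ * Real.log n := by positivity
  specialize h n hT θ hθα hθβ
  set F : ℝ → ℂ := fun t =>
    (∏ j ∈ Finset.range n, (1 + ((θ / (θ + j) : ℝ) : ℂ) * (Complex.exp (t * Complex.I) - 1))) *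
      Complex.exp (-((θ * Real.log n : ℝ) * (t * Complex.I))) with hF
  set y : ℝ := k - θ * Real.log n with hy
  set g : ℝ → ℂ := edgeworthChar (θ * Real.log n) (-(θ * digamma θ)) with hg
  have i2 : MeasureTheory.Integrable fun t : ℝ => g t * Complex.exp (-(y * t * Complex.I)) :=
    integrable_edgeworthChar_mul_cexp hl _ _
  have hFc : Continuous fun t : ℝ => F t * Complex.exp (-(y * t * Complex.I)) := by
    rw [hF]; fun_prop
  have ind : ∀ t : ℝ, (Set.Ioc (-π) π).indicator F t * Complex.exp (-(y * t * Complex.I)) =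
      (Set.Ioc (-π) π).indicator (fun t : ℝ => F t * Complex.exp (-(y * t * Complex.I))) t :=
    fun t => by by_cases ht : t ∈ Set.Ioc (-π) π <;> simp [ht]
  have i1 : MeasureTheory.Integrable fun t : ℝ =>
      (Set.Ioc (-π) π).indicator F t * Complex.exp (-(y * t * Complex.I)) := by
    simp_rw [ind]
    rw [MeasureTheory.integrable_indicator_iff measurableSet_Ioc]
    exact hFc.integrableOn_Ioc
  have e1 : 2 * π * (ewensPMF n θ k : ℂ) =
      ∫ t : ℝ, (Set.Ioc (-π) π).indicator F t * Complex.exp (-(y * t * Complex.I)) := by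
    rw [two_pi_mul_ewensPMF_eq_integral hθ hk,
      intervalIntegral.integral_of_le (by linarith [Real.pi_pos])]
    simp_rw [ind]
    rw [MeasureTheory.integral_indicator measurableSet_Ioc]
    congr 1
    ext t
    rw [hF, mul_assoc, ← Complex.exp_add]
    congr 2
    rw [hy]
    push_cast
    ring
  have e2 := two_pi_mul_edgeworth_eq_integral hθ hTpos k
  set A := Real.exp (-(xnorm n k θ) ^ 2 / 2) / Real.sqrt (2 * π * θ * Real.log n) *
            (1 + H₁ (xnorm n k θ) θ / Real.sqrt (θ * Real.log n))
  have e3 : (2 * π : ℂ) * ((ewensPMF n θ k - A : ℝ) : ℂ) =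
      ∫ t : ℝ, ((Set.Ioc (-π) π).indicator F t * Complex.exp (-(y * t * Complex.I)) -
        g t * Complex.exp (-(y * t * Complex.I))) := by
    rw [MeasureTheory.integral_sub i1 i2, ← e1, ← e2]
    push_cast
    ring
  have hb := MeasureTheory.norm_integral_le_of_norm_le
    ((integrable_exp_neg_mul_sq (b := c * Real.log n) (by positivity)).const_mul (C / Real.log n))
    (f := fun t : ℝ => (Set.Ioc (-π) π).indicator F t * Complex.exp (-(y * t * Complex.I)) -
        g t * Complex.exp (-(y * t * Complex.I))) (Eventually.of_forall fun t => by
      rw [← sub_mul, norm_mul]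
      have : ‖Complex.exp (-(y * t * Complex.I))‖ = 1 := by
        rw [Complex.norm_exp]; simp
      rw [this, mul_one]
      exact h t)
  rw [← e3, MeasureTheory.integral_const_mul, integral_gaussian, norm_mul, Complex.norm_real,
    ← div_div, Real.sqrt_div (by positivity), Real.norm_eq_abs] at hb
  have e4 : ‖(2 * π : ℂ)‖ = 2 * π := by
    rw [norm_mul, Complex.norm_real, Real.norm_of_nonneg Real.pi_pos.le]; simp
  rw [e4] at hb
  have h1 : |ewensPMF n θ k - A| ≤ 2 * π * |ewensPMF n θ k - A| :=
    le_mul_of_one_le_left (abs_nonneg _) (by linarith [Real.pi_gt_three])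
  refine h1.trans (hb.trans (le_of_eq ?_))
  field_simp

/-- The r = 1 case of the Edgeworth expansion for the Ewens distribution. -/
theorem ewens_edgeworth_one (L : Set ℝ) (hL : IsCompact L) (hLpos : L ⊆ Set.Ioi (0 : ℝ)) :
    Tendsto (fun n : ℕ =>
      Real.log n *
        sSup {y : ℝ | ∃ θ ∈ L, ∃ k ∈ Finset.Icc 1 n,
          y = |ewensPMF n θ k -
            Real.exp (-(xnorm n k θ) ^ 2 / 2) / Real.sqrt (2 * π * θ * Real.log n) *
              (1 + H₁ (xnorm n k θ) θ / Real.sqrt (θ * Real.log n))|})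
      atTop (nhds 0) := by
  rcases L.eq_empty_or_nonempty with rfl | hne
  · simp
  obtain ⟨α, hαL, hα⟩ := hL.exists_isLeast hne
  obtain ⟨β, -, hβ⟩ := hL.exists_isGreatest hne
  obtain ⟨C, hC, h⟩ := exists_abs_ewensPMF_sub_le (hLpos hαL) (hβ hαL)
  have hlog : Tendsto (fun n : ℕ => Real.log n) atTop atTop :=
    Real.tendsto_log_atTop.comp tendsto_natCast_atTop_atTop
  have hlim : Tendsto (fun n : ℕ => C / Real.sqrt (Real.log n)) atTop (nhds 0) :=
    (Real.tendsto_sqrt_atTop.comp hlog).const_div_atTop C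
  refine squeeze_zero' ?_ ?_ hlim
  · filter_upwards [hlog.eventually_ge_atTop 1] with n hn
    refine mul_nonneg (by linarith) (Real.sSup_nonneg ?_)
    rintro _ ⟨θ, -, k, -, rfl⟩
    exact abs_nonneg _
  · filter_upwards [hlog.eventually_ge_atTop 1] with n hn
    have hpos : 0 < Real.log n := by linarith
    have hs : sSup {y : ℝ | ∃ θ ∈ L, ∃ k ∈ Finset.Icc 1 n,
          y = |ewensPMF n θ k -
            Real.exp (-(xnorm n k θ) ^ 2 / 2) / Real.sqrt (2 * π * θ * Real.log n) *
              (1 + H₁ (xnorm n k θ) θ / Real.sqrt (θ * Real.log n))|} ≤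
        C / (Real.log n * Real.sqrt (Real.log n)) := by
      refine Real.sSup_le ?_ (by positivity)
      rintro _ ⟨θ, hθ, k, hk, rfl⟩
      exact h n hn θ (hα hθ) (hβ hθ) k (Finset.mem_Icc.1 hk).2
    refine (mul_le_mul_of_nonneg_left hs hpos.le).trans (le_of_eq ?_)
    field_simp
end

section
/- For every n ∈ ℕ, n ≥ 1, the least mode u_n(1) of the Ewens distribution with parameter θ = 1 (equivalently, the smallest k ∈ {1,…,n} maximizing ⟦n,k⟧) belongs to { ⌊log n + γ − 1/2⌋, ⌈log n + γ − 1/2⌉ }, where γ is the Euler–Mascheroni constant. -/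
open Real Filter

/-- The (unsigned) Stirling number of the first kind `⟦n,k⟧`. -/
noncomputable def stirlingFirst (n k : ℕ) : ℕ := (ascPochhammer ℕ n).coeff k

section PoissonBinomial

open Polynomial

variable {ι : Type*} [DecidableEq ι]

/-- The probability generating function of a sum of independent Bernoulli variables with
parameters `p j`, `j ∈ S`. -/
noncomputable def bernoulliSumPGF (p : ι → ℝ) (S : Finset ι) : ℝ[X] :=
  ∏ j ∈ S, (C (1 - p j) + C (p j) * X)

variable {p : ι → ℝ} {S : Finset ι}

lemma bernoulliSumPGF_eq_mul_erase {j : ι} (hj : j ∈ S) :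
    bernoulliSumPGF p S = (C (1 - p j) + C (p j) * X) * bernoulliSumPGF p (S.erase j) :=
  (Finset.mul_prod_erase S _ hj).symm

lemma coeff_zero_bernoulliSumPGF {j : ι} (hj : j ∈ S) :
    (bernoulliSumPGF p S).coeff 0 = (1 - p j) * (bernoulliSumPGF p (S.erase j)).coeff 0 := by
  rw [bernoulliSumPGF_eq_mul_erase hj, add_mul, mul_assoc]
  simp

lemma coeff_succ_bernoulliSumPGF {j : ι} (hj : j ∈ S) (k : ℕ) :
    (bernoulliSumPGF p S).coeff (k + 1) = (1 - p j) * (bernoulliSumPGF p (S.erase j)).coeff (k + 1)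
      + p j * (bernoulliSumPGF p (S.erase j)).coeff k := by
  rw [bernoulliSumPGF_eq_mul_erase hj, add_mul, mul_assoc, coeff_add, coeff_C_mul, coeff_C_mul,
    coeff_X_mul]

lemma coeff_bernoulliSumPGF_nonneg (h0 : ∀ j, 0 ≤ p j) (h1 : ∀ j, p j ≤ 1) (S : Finset ι) (k : ℕ) :
    0 ≤ (bernoulliSumPGF p S).coeff k := by
  induction S using Finset.induction_on generalizing k with
  | empty => simp only [bernoulliSumPGF, Finset.prod_empty, coeff_one]; split_ifs <;> simp
  | insert a S ha ih =>
    have hj := Finset.mem_insert_self a S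
    have h2 : 0 ≤ 1 - p a := sub_nonneg.2 (h1 a)
    cases k with
    | zero =>
      rw [coeff_zero_bernoulliSumPGF hj, Finset.erase_insert ha]
      exact mul_nonneg h2 (ih 0)
    | succ k =>
      rw [coeff_succ_bernoulliSumPGF hj, Finset.erase_insert ha]
      exact add_nonneg (mul_nonneg h2 (ih _)) (mul_nonneg (h0 a) (ih _))

lemma one_sub_mul_coeff_erase_le (h0 : ∀ j, 0 ≤ p j) (h1 : ∀ j, p j ≤ 1) {j : ι} (hj : j ∈ S)
    (k : ℕ) :
    (1 - p j) * (bernoulliSumPGF p (S.erase j)).coeff k ≤ (bernoulliSumPGF p S).coeff k := by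
  cases k with
  | zero => exact (coeff_zero_bernoulliSumPGF hj).ge
  | succ k =>
    rw [coeff_succ_bernoulliSumPGF hj]
    exact le_add_of_nonneg_right (mul_nonneg (h0 j) (coeff_bernoulliSumPGF_nonneg h0 h1 _ _))

/-- Size-biasing identity. -/
lemma succ_mul_coeff_succ_bernoulliSumPGF (p : ι → ℝ) (S : Finset ι) (k : ℕ) :
    ((k : ℝ) + 1) * (bernoulliSumPGF p S).coeff (k + 1)
      = ∑ j ∈ S, p j * (bernoulliSumPGF p (S.erase j)).coeff k := by
  have h : derivative (bernoulliSumPGF p S) = ∑ j ∈ S, C (p j) * bernoulliSumPGF p (S.erase j) := by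
    rw [bernoulliSumPGF, derivative_prod_finset]
    refine Finset.sum_congr rfl fun j _ => ?_
    rw [bernoulliSumPGF, mul_comm]
    simp only [derivative_add, derivative_C, derivative_C_mul, derivative_X, zero_add, mul_one]
  have := congrArg (fun q => q.coeff k) h
  simp only [coeff_derivative, finsetSum_coeff, coeff_C_mul] at this
  rw [← this, mul_comm]

/-- Stein identity at `0`. -/
lemma coeff_one_bernoulliSumPGF (p : ι → ℝ) (S : Finset ι) :
    (bernoulliSumPGF p S).coeff 1 = (∑ j ∈ S, p j) * (bernoulliSumPGF p S).coeff 0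
      + ∑ j ∈ S, p j ^ 2 * (bernoulliSumPGF p (S.erase j)).coeff 0 := by
  have h := succ_mul_coeff_succ_bernoulliSumPGF p S 0
  norm_num at h
  rw [h, Finset.sum_mul, ← Finset.sum_add_distrib]
  refine Finset.sum_congr rfl fun j hj => ?_
  rw [coeff_zero_bernoulliSumPGF hj]
  ring

/-- Stein identity at positive integers. -/
lemma stein_identity_bernoulliSumPGF (p : ι → ℝ) (S : Finset ι) (k : ℕ) :
    ((k : ℝ) + 2) * (bernoulliSumPGF p S).coeff (k + 2)
      = (∑ j ∈ S, p j) * (bernoulliSumPGF p S).coeff (k + 1)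
      + ∑ j ∈ S, p j ^ 2 * ((bernoulliSumPGF p (S.erase j)).coeff (k + 1)
        - (bernoulliSumPGF p (S.erase j)).coeff k) := by
  have h := succ_mul_coeff_succ_bernoulliSumPGF p S (k + 1)
  push_cast at h
  rw [show (k : ℝ) + 2 = k + 1 + 1 by ring, h, Finset.sum_mul, ← Finset.sum_add_distrib]
  refine Finset.sum_congr rfl fun j hj => ?_
  rw [coeff_succ_bernoulliSumPGF hj]
  ring

lemma succ_mul_coeff_succ_bernoulliSumPGF_le (h0 : ∀ j, 0 ≤ p j) (h1 : ∀ j, p j ≤ 1)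
    (S : Finset ι) (k : ℕ) :
    ((k : ℝ) + 1) * (bernoulliSumPGF p S).coeff (k + 1)
      ≤ (∑ j ∈ S, p j) * (bernoulliSumPGF p S).coeff k
      + ∑ j ∈ S, p j ^ 2 * (bernoulliSumPGF p (S.erase j)).coeff k := by
  cases k with
  | zero => simpa using (coeff_one_bernoulliSumPGF p S).le
  | succ k =>
    have h := stein_identity_bernoulliSumPGF p S k
    push_cast
    rw [add_assoc, one_add_one_eq_two, h]
    gcongr with j
    linarith [coeff_bernoulliSumPGF_nonneg h0 h1 (S.erase j) k]

lemma sum_sq_mul_coeff_erase_le (h0 : ∀ j, 0 ≤ p j) (h1 : ∀ j, p j < 1) (S : Finset ι) (k : ℕ) :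
    ∑ j ∈ S, p j ^ 2 * (bernoulliSumPGF p (S.erase j)).coeff k
      ≤ (∑ j ∈ S, p j ^ 2 / (1 - p j)) * (bernoulliSumPGF p S).coeff k := by
  rw [Finset.sum_mul]
  refine Finset.sum_le_sum fun j hj => ?_
  have h2 : 0 < 1 - p j := sub_pos.2 (h1 j)
  rw [div_mul_eq_mul_div, mul_div_assoc]
  gcongr
  rw [le_div_iff₀ h2, mul_comm]
  exact one_sub_mul_coeff_erase_le h0 (fun j => (h1 j).le) hj k

/-- The coefficients increase up to the mean. -/
lemma sum_mul_coeff_bernoulliSumPGF_le (h0 : ∀ j, 0 ≤ p j) (h1 : ∀ j, p j ≤ 1) (S : Finset ι)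
    (k : ℕ) (hk : (k : ℝ) + 1 ≤ ∑ j ∈ S, p j) :
    (∑ j ∈ S, p j) * (bernoulliSumPGF p S).coeff k
      ≤ ((k : ℝ) + 1) * (bernoulliSumPGF p S).coeff (k + 1) := by
  induction S using Finset.strongInduction generalizing k with
  | H S ih =>
    cases k with
    | zero =>
      have h := coeff_one_bernoulliSumPGF p S
      have : 0 ≤ ∑ j ∈ S, p j ^ 2 * (bernoulliSumPGF p (S.erase j)).coeff 0 :=
        Finset.sum_nonneg fun j _ =>
          mul_nonneg (sq_nonneg _) (coeff_bernoulliSumPGF_nonneg h0 h1 _ _)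
      norm_num
      linarith
    | succ k =>
      have h := stein_identity_bernoulliSumPGF p S k
      push_cast at hk ⊢
      rw [add_assoc, one_add_one_eq_two, h, le_add_iff_nonneg_right]
      refine Finset.sum_nonneg fun j hj => mul_nonneg (sq_nonneg _) (sub_nonneg.2 ?_)
      have hs := Finset.add_sum_erase S p hj
      have hk' : (k : ℝ) + 1 ≤ ∑ i ∈ S.erase j, p i := by linarith [h1 j]
      have h3 := ih _ (Finset.erase_ssubset hj) k hk'
      have h4 := mul_le_mul_of_nonneg_right hk'
        (coeff_bernoulliSumPGF_nonneg h0 h1 (S.erase j) k)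
      exact le_of_mul_le_mul_left (h4.trans h3) (by positivity)

/-- If the mean is at most `k + 1 + ε` and the parameters are small enough, then the coefficient
at `k + 2` does not exceed the one at `k`. -/
lemma coeff_add_two_bernoulliSumPGF_le (h0 : ∀ j, 0 ≤ p j) (h1 : ∀ j, p j < 1) (k : ℕ) {ε : ℝ}
    (hε0 : 0 ≤ ε) (hε : ε ≤ 1 / 4) (hS : ∑ j ∈ S, p j ≤ k + 1 + ε)
    (hS' : ∑ j ∈ S, p j ^ 2 / (1 - p j) ≤ 1 / 2 - ε) :
    (bernoulliSumPGF p S).coeff (k + 2) ≤ (bernoulliSumPGF p S).coeff k := by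
  have h1' : ∀ j, p j ≤ 1 := fun j => (h1 j).le
  have hnn := coeff_bernoulliSumPGF_nonneg h0 h1'
  have step : ∀ T ⊆ S,
      (bernoulliSumPGF p T).coeff (k + 1) ≤ 3 / 2 * (bernoulliSumPGF p T).coeff k := by
    intro T hT
    have hμ : ∑ j ∈ T, p j ≤ k + 1 + ε :=
      (Finset.sum_le_sum_of_subset_of_nonneg hT fun j _ _ => h0 j).trans hS
    have hσ : ∑ j ∈ T, p j ^ 2 / (1 - p j) ≤ 1 / 2 - ε :=
      (Finset.sum_le_sum_of_subset_of_nonneg hT fun j _ _ =>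
        div_nonneg (sq_nonneg _) (sub_nonneg.2 (h1' j))).trans hS'
    have a := succ_mul_coeff_succ_bernoulliSumPGF_le h0 h1' T k
    have b := sum_sq_mul_coeff_erase_le h0 h1 T k
    have c := mul_le_mul_of_nonneg_right (add_le_add hμ hσ) (hnn T k)
    have d := mul_nonneg (Nat.cast_nonneg (α := ℝ) k) (hnn T k)
    refine le_of_mul_le_mul_left (a := (k : ℝ) + 1) ?_ (by positivity)
    linarith
  have a := succ_mul_coeff_succ_bernoulliSumPGF_le h0 h1' S k
  have b := stein_identity_bernoulliSumPGF p S k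
  have c : ∑ j ∈ S, p j ^ 2 * (bernoulliSumPGF p (S.erase j)).coeff (k + 1)
      ≤ 3 / 2 * ((1 / 2 - ε) * (bernoulliSumPGF p S).coeff k) := by
    calc _ ≤ ∑ j ∈ S, p j ^ 2 * (3 / 2 * (bernoulliSumPGF p (S.erase j)).coeff k) := by
          gcongr with j
          exact step _ (Finset.erase_subset _ _)
      _ = 3 / 2 * ∑ j ∈ S, p j ^ 2 * (bernoulliSumPGF p (S.erase j)).coeff k := by
          rw [Finset.mul_sum]
          exact Finset.sum_congr rfl fun j _ => by ring
      _ ≤ _ := by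
          gcongr
          exact (sum_sq_mul_coeff_erase_le h0 h1 S k).trans
            (mul_le_mul_of_nonneg_right hS' (hnn S k))
  simp only [mul_sub, Finset.sum_sub_distrib] at b
  have d := mul_le_mul_of_nonneg_right hS (add_nonneg (hnn S k) (hnn S (k + 1)))
  have e := mul_le_mul_of_nonneg_left (step S subset_rfl) hε0
  have f := mul_le_mul_of_nonneg_right hε (hnn S k)
  refine le_of_mul_le_mul_left (a := (k : ℝ) + 2) ?_ (by positivity)
  linarith

end PoissonBinomial

section Stirling

open Polynomial

lemma map_ascPochhammer_eq (n : ℕ) (hn : 1 ≤ n) :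
    (ascPochhammer ℕ n).map (Nat.castRingHom ℝ)
      = C (n.factorial : ℝ) * X * bernoulliSumPGF (fun j : ℕ => (j : ℝ)⁻¹) (Finset.Icc 2 n) := by
  induction n, hn using Nat.le_induction with
  | base => simp [bernoulliSumPGF]
  | succ n hn ih =>
    have hn0 : (n : ℝ) + 1 ≠ 0 := by positivity
    rw [ascPochhammer_succ_right, Polynomial.map_mul, ih, bernoulliSumPGF, bernoulliSumPGF,
      Finset.prod_Icc_succ_top (by lia)]
    have h : (X + (n : ℝ[X])) = C ((n : ℝ) + 1) *
        (C (1 - ((n + 1 : ℕ) : ℝ)⁻¹) + C (((n + 1 : ℕ) : ℝ)⁻¹) * X) := by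
      rw [mul_add, ← mul_assoc, ← C_mul, ← C_mul, ← C_eq_natCast]
      push_cast
      rw [mul_sub, mul_inv_cancel₀ hn0]
      simp [add_comm]
    rw [Nat.factorial_succ]
    push_cast
    rw [Polynomial.map_add, map_X, Polynomial.map_natCast, h]
    push_cast
    rw [C_mul]
    ring

lemma stirlingFirst_succ (n k : ℕ) (hn : 1 ≤ n) :
    (stirlingFirst n (k + 1) : ℝ) = n.factorial *
      (bernoulliSumPGF (fun j : ℕ => (j : ℝ)⁻¹) (Finset.Icc 2 n)).coeff k := by
  have h := congrArg (fun q => q.coeff (k + 1)) (map_ascPochhammer_eq n hn)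
  simp only [coeff_map, mul_assoc, coeff_C_mul, coeff_X_mul] at h
  exact h

lemma sum_Icc_two_inv (n : ℕ) (hn : 1 ≤ n) :
    ∑ j ∈ Finset.Icc 2 n, (j : ℝ)⁻¹ = harmonic n - 1 := by
  induction n, hn using Nat.le_induction with
  | base => simp
  | succ n hn ih =>
    rw [Finset.sum_Icc_succ_top (by lia), ih, harmonic_succ]
    push_cast
    ring

lemma sum_Icc_three_inv_sq_div (n : ℕ) (hn : 2 ≤ n) :
    ∑ j ∈ Finset.Icc 3 n, (j : ℝ)⁻¹ ^ 2 / (1 - (j : ℝ)⁻¹) = 1 / 2 - (n : ℝ)⁻¹ := by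
  induction n, hn using Nat.le_induction with
  | base => norm_num
  | succ n hn ih =>
    have : (n : ℝ) ≠ 0 := by positivity
    have : (n : ℝ) + 1 ≠ 0 := by positivity
    rw [Finset.sum_Icc_succ_top (by lia), ih]
    push_cast
    rw [show 1 - ((n : ℝ) + 1)⁻¹ = n / (n + 1) by field_simp; ring]
    field_simp
    ring

lemma log_add_eulerMascheroniConstant_lt_harmonic {n : ℕ} (hn : 1 ≤ n) :
    Real.log n + Real.eulerMascheroniConstant < harmonic n := by
  have h := Real.eulerMascheroniConstant_lt_eulerMascheroniSeq' n
  rw [Real.eulerMascheroniSeq', if_neg (by lia)] at h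
  linarith

lemma harmonic_lt_log_add_eulerMascheroniConstant {n : ℕ} (hn : 1 ≤ n) :
    (harmonic n : ℝ) < Real.log n + Real.eulerMascheroniConstant + (n : ℝ)⁻¹ := by
  have h := Real.eulerMascheroniSeq_lt_eulerMascheroniConstant n
  rw [Real.eulerMascheroniSeq] at h
  have hn0 : (0 : ℝ) < n := by positivity
  have h2 := Real.log_le_sub_one_of_pos (x := ((n : ℝ) + 1) / n) (by positivity)
  rw [Real.log_div (by positivity) hn0.ne', add_div, div_self hn0.ne', one_div] at h2
  linarith

lemma stirlingFirst_lt_succ {n k : ℕ} (hn : 1 ≤ n) (hk : 1 ≤ k) (hpos : 0 < stirlingFirst n k)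
    (h : (k : ℝ) ≤ Real.log n + Real.eulerMascheroniConstant - 3 / 2) :
    stirlingFirst n k < stirlingFirst n (k + 1) := by
  obtain ⟨t, rfl⟩ := Nat.exists_eq_add_of_le' hk
  have hμ := sum_Icc_two_inv n hn
  have hH := log_add_eulerMascheroniConstant_lt_harmonic hn
  push_cast at h
  have key := sum_mul_coeff_bernoulliSumPGF_le (p := fun j : ℕ => (j : ℝ)⁻¹)
    (fun j => by positivity) Nat.cast_inv_le_one (Finset.Icc 2 n) t (by linarith)
  have hfac : (0 : ℝ) < n.factorial := by positivity
  have hc : 0 < (bernoulliSumPGF (fun j : ℕ => (j : ℝ)⁻¹) (Finset.Icc 2 n)).coeff t := by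
    have : (0 : ℝ) < stirlingFirst n (t + 1) := mod_cast hpos
    rw [stirlingFirst_succ n t hn] at this
    exact pos_of_mul_pos_right this hfac.le
  rw [← Nat.cast_lt (α := ℝ), stirlingFirst_succ n t hn, stirlingFirst_succ n (t + 1) hn]
  refine mul_lt_mul_of_pos_left (lt_of_mul_lt_mul_left (a := (t : ℝ) + 1) ?_ (by positivity)) hfac
  refine lt_of_lt_of_le ?_ key
  exact mul_lt_mul_of_pos_right (by linarith) hc

lemma stirlingFirst_add_three_le {n k : ℕ} (hn : 4 ≤ n)
    (h : Real.log n + Real.eulerMascheroniConstant + 1 / 2 ≤ k + 3) :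
    stirlingFirst n (k + 3) ≤ stirlingFirst n (k + 2) := by
  set p : ℕ → ℝ := fun j => if j ≤ 1 then 0 else (j : ℝ)⁻¹ with hp
  have hpe : ∀ j, 2 ≤ j → p j = (j : ℝ)⁻¹ := fun j hj => if_neg (by lia)
  have hp0 : ∀ j, 0 ≤ p j := fun j => by simp only [hp]; split_ifs <;> positivity
  have hp1 : ∀ j, p j < 1 := fun j => by
    simp only [hp]
    split_ifs with hj
    · exact one_pos
    · exact inv_lt_one_of_one_lt₀ (by exact_mod_cast (by lia : 1 < j))
  have hpS : ∀ j ∈ Finset.Icc 3 n, p j = (j : ℝ)⁻¹ := fun j hj =>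
    hpe j (by have := (Finset.mem_Icc.1 hj).1; lia)
  have herase : (Finset.Icc 2 n).erase 2 = Finset.Icc 3 n := by
    ext j; simp only [Finset.mem_erase, Finset.mem_Icc]; lia
  have h2 : 2 ∈ Finset.Icc 2 n := Finset.mem_Icc.2 ⟨le_rfl, by lia⟩
  have hPQ : bernoulliSumPGF (fun j : ℕ => (j : ℝ)⁻¹) (Finset.Icc 2 n)
      = bernoulliSumPGF p (Finset.Icc 2 n) :=
    Finset.prod_congr rfl fun j hj => by rw [hpe j (Finset.mem_Icc.1 hj).1]
  have hn4 : (n : ℝ)⁻¹ ≤ 1 / 4 := by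
    rw [inv_le_comm₀ (by positivity) (by norm_num)]
    norm_num
    exact_mod_cast hn
  have key := coeff_add_two_bernoulliSumPGF_le (S := Finset.Icc 3 n) hp0 hp1 k
    (ε := (n : ℝ)⁻¹) (by positivity) hn4
    (by
      rw [Finset.sum_congr rfl hpS, ← herase]
      have := Finset.add_sum_erase (Finset.Icc 2 n) (fun j : ℕ => (j : ℝ)⁻¹) h2
      rw [sum_Icc_two_inv n (by lia)] at this
      have := harmonic_lt_log_add_eulerMascheroniConstant (n := n) (by lia)
      norm_num at *
      linarith)
    (by
      rw [← sum_Icc_three_inv_sq_div n (by lia)]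
      exact (Finset.sum_congr rfl fun j hj => by rw [hpS j hj]).le)
  rw [← Nat.cast_le (α := ℝ), stirlingFirst_succ n (k + 2) (by lia),
    stirlingFirst_succ n (k + 1) (by lia), hPQ]
  gcongr
  rw [coeff_succ_bernoulliSumPGF h2 (k + 1), coeff_succ_bernoulliSumPGF h2 k, herase, hpe 2 le_rfl]
  norm_num at *
  linarith

lemma stirlingFirst_succ_le {n k : ℕ} (hn : 1 ≤ n) (hk : k < n)
    (h : Real.log n + Real.eulerMascheroniConstant + 1 / 2 ≤ k + 1) :
    stirlingFirst n (k + 1) ≤ stirlingFirst n k := by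
  have hγ := Real.one_half_lt_eulerMascheroniConstant
  have hk0 : k ≠ 0 := by
    rintro rfl
    have := Real.log_natCast_nonneg n
    norm_num at h
    linarith
  have hk1 : 3 ≤ n → k ≠ 1 := by
    rintro hn3 rfl
    have : 1 < Real.log n := by
      rw [Real.lt_log_iff_exp_lt (by positivity)]
      have : (3 : ℝ) ≤ n := mod_cast hn3
      linarith [Real.exp_one_lt_three]
    norm_num at h
    linarith
  rcases le_or_gt 4 n with h4 | h4
  · obtain ⟨t, rfl⟩ : ∃ t, k = t + 2 := ⟨k - 2, by have := hk1 (by lia); lia⟩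
    exact stirlingFirst_add_three_le h4 (by push_cast at h; linarith)
  · have : n = 2 ∧ k = 1 ∨ n = 3 ∧ k = 2 := by lia
    rcases this with ⟨rfl, rfl⟩ | ⟨rfl, rfl⟩ <;>
      simp [stirlingFirst, ascPochhammer_succ_right, mul_add, add_mul, coeff_X]

end Stirling

/-- For every `n ≥ 1`, the least mode of the Ewens distribution with `θ = 1`, i.e. the
smallest `k ∈ {1,…,n}` maximizing `⟦n,k⟧`, is `⌊log n + γ − 1/2⌋` or `⌈log n + γ − 1/2⌉`. -/
theorem stirling_least_mode (n : ℕ) (hn : 1 ≤ n) (u : ℕ)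
    (hmem : u ∈ Finset.Icc 1 n)
    (hmax : ∀ k ∈ Finset.Icc 1 n, stirlingFirst n k ≤ stirlingFirst n u)
    (hleast : ∀ v ∈ Finset.Icc 1 n,
      (∀ k ∈ Finset.Icc 1 n, stirlingFirst n k ≤ stirlingFirst n v) → u ≤ v) :
    (u : ℤ) = ⌊Real.log n + Real.eulerMascheroniConstant - 1 / 2⌋ ∨
      (u : ℤ) = ⌈Real.log n + Real.eulerMascheroniConstant - 1 / 2⌉ := by
  have hu := Finset.mem_Icc.1 hmem
  have hn1 : 1 ≤ stirlingFirst n n := by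
    have h := monic_ascPochhammer ℕ n
    rw [Polynomial.Monic, Polynomial.leadingCoeff, ascPochhammer_natDegree] at h
    exact h.ge
  have hpos : 0 < stirlingFirst n u := hn1.trans (hmax n (Finset.mem_Icc.2 ⟨hn, le_rfl⟩))
  have hlower : Real.log n + Real.eulerMascheroniConstant - 1 / 2 < u + 1 := by
    by_contra! h
    have hlog := Real.log_le_sub_one_of_pos (x := (n : ℝ)) (by positivity)
    have hγ := Real.eulerMascheroniConstant_lt_two_thirds
    have hun : u < n := by
      rw [← Nat.cast_lt (α := ℝ)]
      linarith
    have hlt := stirlingFirst_lt_succ hn hu.1 hpos (by linarith)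
    exact hlt.not_ge (hmax _ (Finset.mem_Icc.2 ⟨by lia, by lia⟩))
  have hupper : (u : ℝ) - 1 < Real.log n + Real.eulerMascheroniConstant - 1 / 2 := by
    by_contra! h
    have hγ := Real.one_half_lt_eulerMascheroniConstant
    have hlog := Real.log_natCast_nonneg n
    have hu2 : 1 < u := by
      rw [← Nat.cast_lt (α := ℝ)]
      push_cast
      linarith
    obtain ⟨k, rfl⟩ := Nat.exists_eq_add_of_le' hu.1
    push_cast at h
    have hle := stirlingFirst_succ_le hn (by lia : k < n) (by linarith)
    have := hleast k (Finset.mem_Icc.2 ⟨by lia, by lia⟩) fun j hj => (hmax j hj).trans hle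
    lia
  rcases le_total (u : ℝ) (Real.log n + Real.eulerMascheroniConstant - 1 / 2) with h | h
  · exact Or.inl (Int.floor_eq_iff.2 ⟨mod_cast h, mod_cast hlower⟩).symm
  · exact Or.inr (Int.ceil_eq_iff.2 ⟨mod_cast hupper, mod_cast h⟩).symm
end
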